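/- arXiv:1408.4403 — 5 statements merged into one kernel-verified Lean document; each statement's English description precedes it below -/
import Mathlib

section
/- Consider the M₂ model on a closed (periodic) chain of N sites with positive real weights λ_x, μ_x (indices taken modulo N). Then the cohomology of the raising supercharge Q̄₊ at fermion number f has complex dimension: 3 if N = 4n and f = 2n; 1 if N = 4n+1 and f = 2n; 1 if N = 4n+2 and f = 2n+1; 1 if N = 4n+3 and f = 2n+2; and 0 for all other pairs (N, f). Consequently the periodic model has exactly 3 zero-energy states (all with f = N/2) when N is divisible by 4, and exactly one zero-energy state (with f = ⌊N/2⌋ for N = 4n+1, f = N/2 for N = 4n+2, and f = ⌈N/2⌉ for N = 4n+3) otherwise. -/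
/-- A configuration of the closed M₂ chain of `N` sites: sites are labelled by
`ZMod N` and no three cyclically consecutive sites are occupied. -/
def ValidClosed (N : ℕ) (c : ZMod N → Bool) : Prop :=
  ∀ x : ZMod N, ¬(c x = true ∧ c (x + 1) = true ∧ c (x + 2) = true)

/-- Remove the particle at site `x`. -/
def removeAtC {N : ℕ} (c : ZMod N → Bool) (x : ZMod N) : ZMod N → Bool :=
  fun y => if y = x then false else c y

/-- The fermion number of a configuration. -/
def fcountClosed (N : ℕ) (c : ZMod N → Bool) : ℕ :=
  ((Finset.Icc 1 N).filter (fun y : ℕ => c (y : ZMod N) = true)).card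

/-- The fermionic string `(−1)^{number of occupied sites y < x}` for `x ∈ {1,…,N}`. -/
noncomputable def signClosed (N : ℕ) (c : ZMod N → Bool) (x : ℕ) : ℂ :=
  (-1 : ℂ) ^ (((Finset.Ico 1 x).filter (fun y : ℕ => c (y : ZMod N) = true)).card)

/-- The amplitude `A_x`: `λ_x μ_x` if `x` is the first member of a pair, `λ_x μ_{x−1}`
if it is the second member of a pair, and `λ_x` if the particle at `x` is isolated. -/
noncomputable def ampClosed {N : ℕ} (lam mu : ZMod N → ℝ) (c : ZMod N → Bool)
    (x : ZMod N) : ℂ :=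
  if c (x + 1) = true then ((lam x * mu x : ℝ) : ℂ)
  else if c (x - 1) = true then ((lam x * mu (x - 1) : ℝ) : ℂ)
  else ((lam x : ℝ) : ℂ)

/-- The subspace `ℋ_{N,g}` of states supported on admissible configurations with
exactly `g` particles. -/
noncomputable def gradeClosed (N : ℕ) (g : ℤ) : Submodule ℂ ((ZMod N → Bool) → ℂ) where
  carrier := {ψ | ∀ c, ψ c ≠ 0 → ValidClosed N c ∧ (fcountClosed N c : ℤ) = g}
  add_mem' := by
    intro a b ha hb c hc
    by_cases h : a c = 0
    · exact hb c (by simpa [h] using hc)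
    · exact ha c h
  zero_mem' := by intro c hc; exact absurd rfl hc
  smul_mem' := by
    intro r a ha c hc
    refine ha c fun h => hc ?_
    simp [h]

section Linear

open Module

variable {K ι : Type*} [Field K]

/-- The subspace of functions vanishing outside `S`. -/
def supportedOn (K : Type*) [Field K] (S : Set ι) : Submodule K (ι → K) where
  carrier := {ψ | ∀ c, ψ c ≠ 0 → c ∈ S}
  add_mem' := by
    intro a b ha hb c hc
    by_cases h : a c = 0
    · exact hb c (by simpa [h] using hc)
    · exact ha c h
  zero_mem' := by intro c hc; exact absurd rfl hc
  smul_mem' := by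
    intro r a ha c hc
    refine ha c fun h => hc ?_
    simp [h]

theorem supportedOn_mono {S T : Set ι} (h : S ⊆ T) : supportedOn K S ≤ supportedOn K T :=
  fun _ hψ c hc => h (hψ c hc)

theorem finrank_supportedOn [Finite ι] (S : Set ι) :
    finrank K (supportedOn K S) = S.ncard := by
  classical
  have := Fintype.ofFinite ι
  let e : supportedOn K S ≃ₗ[K] (S → K) :=
    { toFun := fun ψ c => ψ.1 c
      map_add' := fun _ _ => rfl
      map_smul' := fun _ _ => rfl
      invFun := fun φ => ⟨fun c => if h : c ∈ S then φ ⟨c, h⟩ else 0, fun c hc => by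
        by_contra h
        simp [h] at hc⟩
      left_inv := fun ψ => by
        ext c
        by_cases h : c ∈ S
        · simp [h]
        · have : ψ.1 c = 0 := by
            by_contra h'
            exact h (ψ.2 c h')
          simp [h, this]
      right_inv := fun φ => by
        ext c
        simp }
  rw [e.finrank_eq, finrank_fintype_fun_eq_card, ← Nat.card_eq_fintype_card, Nat.card_coe_set_eq]

/-- If the block of `D` from `L` to its image under `m` is triangular with respect to `r`, with
nonzero diagonal, then `D` has rank at least `#L` on functions supported on any `S ⊇ L`. -/
theorem ncard_le_finrank_map_of_triangular [Finite ι] (D : (ι → K) →ₗ[K] (ι → K))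
    {L S : Set ι} (hLS : L ⊆ S) (m : ι → ι) (r : ι → ℕ)
    (h : ∀ ψ ∈ supportedOn K L, ∀ c ∈ L, (∀ c' ∈ L, r c' < r c → ψ c' = 0) →
      D ψ (m c) = 0 → ψ c = 0) :
    L.ncard ≤ finrank K ((supportedOn K S).map D) := by
  have hinj : Function.Injective (D.domRestrict (supportedOn K L)) := by
    rw [← LinearMap.ker_eq_bot, LinearMap.ker_eq_bot']
    rintro ⟨ψ, hψ⟩ hD
    have hD' : D ψ = 0 := hD
    have key : ∀ n, ∀ c ∈ L, r c = n → ψ c = 0 := by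
      intro n
      induction n using Nat.strong_induction_on with
      | _ n ih =>
        rintro c hc rfl
        exact h ψ hψ c hc (fun c' hc' hr => ih _ hr c' hc' rfl) (by rw [hD']; rfl)
    ext c
    by_contra hc
    exact hc (key _ c (hψ c hc) rfl)
  have h1 := LinearMap.finrank_range_of_inj hinj
  rw [LinearMap.range_domRestrict, finrank_supportedOn] at h1
  rw [← h1]
  exact Submodule.finrank_mono (Submodule.map_mono (supportedOn_mono hLS))

theorem finrank_cohomology_add {V : Type*} [AddCommGroup V] [Module K V] [FiniteDimensional K V]
    (D : V →ₗ[K] V) (A B : Submodule K V) (hBA : B.map D ≤ LinearMap.ker D ⊓ A) :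
    finrank K (↥(LinearMap.ker D ⊓ A) ⧸
        Submodule.comap (LinearMap.ker D ⊓ A).subtype (B.map D)) +
      finrank K (B.map D) + finrank K (A.map D) = finrank K A := by
  have h1 := Submodule.finrank_quotient_add_finrank
    (Submodule.comap (LinearMap.ker D ⊓ A).subtype (B.map D))
  rw [(Submodule.comapSubtypeEquivOfLe hBA).finrank_eq] at h1
  have h2 := LinearMap.finrank_range_add_finrank_ker (D.domRestrict A)
  rw [LinearMap.range_domRestrict, LinearMap.ker_domRestrict] at h2
  have h3 : finrank K ↥(LinearMap.ker D ⊓ A) =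
      finrank K ↥(Submodule.comap A.subtype (LinearMap.ker D)) := by
    rw [← Submodule.finrank_map_subtype_eq A, Submodule.map_comap_subtype, inf_comm]
  omega

/-- A perfect acyclic matching computes cohomology: `S g` are the cells of degree `g`, `L g` those
matched with a cell of degree `g + 1`, and `C g` the critical ones. If all critical cells sit in a
single degree, the cohomology has dimension `#(C g)` in degree `g`. -/
theorem finrank_cohomology_eq_ncard_critical [Finite ι] (D : (ι → K) →ₗ[K] (ι → K))
    (S L C : ℤ → Set ι)
    (hmap : ∀ g, (supportedOn K (S g)).map D ≤ LinearMap.ker D ⊓ supportedOn K (S (g + 1)))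
    (hcard : ∀ g, (S g).ncard = (L g).ncard + (L (g - 1)).ncard + (C g).ncard)
    (hrank : ∀ g, (L g).ncard ≤ finrank K ((supportedOn K (S g)).map D))
    (d : ℤ) (hC : ∀ g, g ≠ d → C g = ∅) (g : ℤ) :
    finrank K (↥(LinearMap.ker D ⊓ supportedOn K (S g)) ⧸
        Submodule.comap (LinearMap.ker D ⊓ supportedOn K (S g)).subtype
          ((supportedOn K (S (g - 1))).map D)) = (C g).ncard := by
  have key : ∀ g, _ := fun g => finrank_cohomology_add D (supportedOn K (S g))
    (supportedOn K (S (g - 1))) (by simpa using hmap (g - 1))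
  simp only [finrank_supportedOn, hcard] at key
  have k0 := key g
  have r0 := hrank g
  have r1 := hrank (g - 1)
  by_cases hg : g = d
  · subst hg
    have k1 := key (g + 1)
    have k2 := key (g - 1)
    have c1 : (C (g + 1)).ncard = 0 := by rw [hC _ (by omega), Set.ncard_empty]
    have c2 : (C (g - 1)).ncard = 0 := by rw [hC _ (by omega), Set.ncard_empty]
    have r2 := hrank (g + 1)
    have r3 := hrank (g - 1 - 1)
    rw [add_sub_cancel_right] at k1
    omega
  · have c0 : (C g).ncard = 0 := by rw [hC _ hg, Set.ncard_empty]
    omega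

end Linear

section Sites

variable {N : ℕ}

/-- Site `i`, read modulo `N`, is occupied. -/
def Occ (c : ZMod N → Bool) (i : ℕ) : Prop := c (i : ZMod N) = true

/-- Flip the occupation of site `p`. -/
def toggle (c : ZMod N → Bool) (p : ℕ) : ZMod N → Bool :=
  fun y => if y = (p : ZMod N) then !c y else c y

theorem natCast_zmod_eq_iff {i j : ℕ} (hi : 1 ≤ i) (hiN : i ≤ N) (hj : 1 ≤ j) (hjN : j ≤ N) :
    (i : ZMod N) = (j : ZMod N) ↔ i = j := by
  refine ⟨fun h => ?_, fun h => by rw [h]⟩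
  have h1 : ((i : ℤ) : ZMod N) = ((j : ℤ) : ZMod N) := by exact_mod_cast h
  rw [ZMod.intCast_eq_intCast_iff_dvd_sub] at h1
  have h2 := Int.eq_zero_of_abs_lt_dvd h1 (by rw [abs_lt]; constructor <;> omega)
  omega

theorem exists_site (hN : 1 ≤ N) (z : ZMod N) : ∃ i : ℕ, 1 ≤ i ∧ i ≤ N ∧ (i : ZMod N) = z := by
  have : NeZero N := ⟨by omega⟩
  by_cases h : z.val = 0
  · refine ⟨N, hN, le_rfl, ?_⟩
    rw [ZMod.natCast_self, (ZMod.val_eq_zero z).1 h]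
  · exact ⟨z.val, by omega, (ZMod.val_lt z).le, ZMod.natCast_zmod_val z⟩

theorem occ_add_self (c : ZMod N → Bool) (i : ℕ) : Occ c (N + i) ↔ Occ c i := by
  simp [Occ]

theorem occ_ext (hN : 1 ≤ N) {c c' : ZMod N → Bool}
    (h : ∀ i, 1 ≤ i → i ≤ N → (Occ c i ↔ Occ c' i)) : c = c' := by
  funext z
  obtain ⟨i, hi, hiN, rfl⟩ := exists_site hN z
  exact Bool.eq_iff_iff.2 (h i hi hiN)

theorem occ_toggle {c : ZMod N → Bool} {p i : ℕ} (hp : 1 ≤ p) (hpN : p ≤ N) (hi : 1 ≤ i)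
    (hiN : i ≤ N) : Occ (toggle c p) i ↔ if i = p then ¬ Occ c i else Occ c i := by
  unfold Occ toggle
  by_cases h : i = p
  · simp [h]
  · simp [h, natCast_zmod_eq_iff hi hiN hp hpN]

theorem occ_removeAtC {c : ZMod N → Bool} {p i : ℕ} (hp : 1 ≤ p) (hpN : p ≤ N) (hi : 1 ≤ i)
    (hiN : i ≤ N) : Occ (removeAtC c p) i ↔ i ≠ p ∧ Occ c i := by
  unfold Occ removeAtC
  by_cases h : i = p
  · simp [h]
  · simp [h, natCast_zmod_eq_iff hi hiN hp hpN]

theorem toggle_toggle (c : ZMod N → Bool) (p : ℕ) : toggle (toggle c p) p = c := by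
  ext y
  by_cases h : y = (p : ZMod N) <;> simp [toggle, h]

theorem removeAtC_toggle {c : ZMod N → Bool} {p : ℕ} (h : ¬ Occ c p) :
    removeAtC (toggle c p) p = c := by
  ext y
  by_cases hy : y = (p : ZMod N)
  · subst hy; simpa [removeAtC, toggle, Occ] using h
  · simp [removeAtC, toggle, hy]

theorem toggle_eq_removeAtC {c : ZMod N → Bool} {p : ℕ} (h : Occ c p) :
    toggle c p = removeAtC c p := by
  ext y
  by_cases hy : y = (p : ZMod N)
  · subst hy; simpa [removeAtC, toggle, Occ] using h
  · simp [removeAtC, toggle, hy]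

theorem ValidClosed.not_occ {c : ZMod N → Bool} (h : ValidClosed N c) (i : ℕ) :
    ¬(Occ c i ∧ Occ c (i + 1) ∧ Occ c (i + 2)) := by
  simpa [Occ] using h (i : ZMod N)

theorem validClosed_iff (hN : 1 ≤ N) {c : ZMod N → Bool} :
    ValidClosed N c ↔
      (∀ i, 1 ≤ i → i + 2 ≤ N → ¬(Occ c i ∧ Occ c (i + 1) ∧ Occ c (i + 2))) ∧
      (2 ≤ N → ¬(Occ c (N - 1) ∧ Occ c N ∧ Occ c 1) ∧ ¬(Occ c N ∧ Occ c 1 ∧ Occ c 2)) ∧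
      (N = 1 → ¬ Occ c 1) := by
  have e1 := occ_add_self c 1
  have e2 := occ_add_self c 2
  constructor
  · intro h
    refine ⟨fun i _ _ => h.not_occ i, fun h2 => ⟨?_, ?_⟩, ?_⟩
    · have := h.not_occ (N - 1)
      rw [show N - 1 + 1 = N by omega, show N - 1 + 2 = N + 1 by omega, e1] at this
      exact this
    · have := h.not_occ N
      rwa [e1, e2] at this
    · rintro rfl
      have := h.not_occ 1
      have e0 := occ_add_self c 1
      have e3 := occ_add_self c 2
      simp only [Nat.reduceAdd] at *
      tauto
  · rintro ⟨h1, h2, h3⟩ z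
    obtain ⟨i, hi, hiN, rfl⟩ := exists_site hN z
    change ¬(Occ c i ∧ c _ = true ∧ c _ = true)
    have : ¬(Occ c i ∧ Occ c (i + 1) ∧ Occ c (i + 2)) := by
      by_cases hi2 : i + 2 ≤ N
      · exact h1 i hi hi2
      · by_cases hN1 : N = 1
        · obtain rfl : i = 1 := by omega
          tauto
        · obtain rfl | rfl : i = N - 1 ∨ i = N := by omega
          · rw [show N - 1 + 1 = N by omega, show N - 1 + 2 = N + 1 by omega, e1]
            exact (h2 (by omega)).1
          · rw [e1, e2]
            exact (h2 (by omega)).2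
    simpa [Occ] using this

theorem ValidClosed.removeAtC {c : ZMod N → Bool} (h : ValidClosed N c) (x : ZMod N) :
    ValidClosed N (removeAtC c x) := by
  intro y hy
  refine h y ?_
  simp only [_root_.removeAtC] at hy
  grind

theorem fcountClosed_eq_sum (c : ZMod N → Bool) [DecidablePred (Occ c)] :
    fcountClosed N c = ∑ i ∈ Finset.range N, if Occ c (i + 1) then 1 else 0 := by
  rw [fcountClosed, Finset.card_filter, Finset.range_eq_Ico,
    Finset.sum_Ico_add' (fun i => if Occ c i then 1 else 0) 0 N 1]
  refine Finset.sum_congr (by ext; simp) fun i _ => ?_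
  exact if_congr Iff.rfl rfl rfl

theorem fcountClosed_removeAtC {c : ZMod N → Bool} {x : ℕ} (hx : 1 ≤ x) (hxN : x ≤ N)
    (hc : Occ c x) : fcountClosed N (removeAtC c x) + 1 = fcountClosed N c := by
  unfold fcountClosed
  rw [← Finset.card_erase_add_one
    (show x ∈ (Finset.Icc 1 N).filter (fun y : ℕ => c (y : ZMod N) = true) by
      simpa using ⟨⟨hx, hxN⟩, hc⟩)]
  congr 2
  ext y
  simp only [Finset.mem_filter, Finset.mem_Icc, Finset.mem_erase]
  have := fun h1 h2 => occ_removeAtC (c := c) hx hxN (i := y) h1 h2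
  simp only [Occ] at this
  grind

theorem fcountClosed_toggle {c : ZMod N → Bool} {x : ℕ} (hx : 1 ≤ x) (hxN : x ≤ N)
    (hc : ¬ Occ c x) : fcountClosed N (toggle c x) = fcountClosed N c + 1 := by
  rw [← fcountClosed_removeAtC hx hxN (c := toggle c x), removeAtC_toggle hc]
  rw [occ_toggle hx hxN hx hxN]
  simpa using hc

end Sites

section Matching

variable {N : ℕ}

/-- A particle at site `1` is compatible with the rest of `c`. -/
def FirstFree (c : ZMod N → Bool) : Prop :=
  2 ≤ N ∧ ¬(Occ c 2 ∧ Occ c 3) ∧ ¬(Occ c N ∧ Occ c 2) ∧ ¬(Occ c (N - 1) ∧ Occ c N)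

open Classical in
/-- The way in which site `1` is blocked: `0` if it is free, and otherwise `3`, `2` or `1`
according to the occupation of the sites `2` and `3`. -/
noncomputable def kind (c : ZMod N → Bool) : ℕ :=
  if FirstFree c then 0 else if Occ c 2 ∧ Occ c 3 then 3 else if Occ c 2 then 2 else 1

/-- The candidate pivot sites of a configuration of kind `k`. -/
def IsCandidate (N k p : ℕ) : Prop :=
  (k = 0 ∧ p = 1) ∨ (k = 3 ∧ 5 ≤ p ∧ p ≤ N ∧ p % 4 = 1) ∨
    (k = 2 ∧ 4 ≤ p ∧ p + 1 ≤ N ∧ p % 4 = 0) ∨ (k = 1 ∧ 3 ≤ p ∧ p + 3 ≤ N ∧ p % 4 = 3)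

/-- The sites `p`, `p + 1`, `p + 2` read empty, occupied, occupied. -/
def IsBlocked (c : ZMod N → Bool) (p : ℕ) : Prop :=
  ¬ Occ c p ∧ Occ c (p + 1) ∧ Occ c (p + 2)

/-- `p` is the first candidate site of `c` which is not blocked; toggling it defines the
matching. -/
def IsPivot (c : ZMod N → Bool) (p : ℕ) : Prop :=
  IsCandidate N (kind c) p ∧ ¬ IsBlocked c p ∧
    ∀ q < p, IsCandidate N (kind c) q → IsBlocked c q

theorem IsPivot.unique {c : ZMod N → Bool} {p q : ℕ} (hp : IsPivot c p) (hq : IsPivot c q) :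
    p = q := by
  rcases lt_trichotomy p q with h | h | h
  · exact absurd (hq.2.2 p h hp.1) hp.2.1
  · exact h
  · exact absurd (hp.2.2 q h hq.1) hq.2.1

theorem IsPivot.bounds (hN : 1 ≤ N) {c : ZMod N → Bool} {p : ℕ} (hp : IsPivot c p) :
    1 ≤ p ∧ p ≤ N := by
  have := hp.1
  unfold IsCandidate at this
  omega

theorem kind_eq_zero_iff {c : ZMod N → Bool} : kind c = 0 ↔ FirstFree c := by
  unfold kind; split_ifs <;> simp_all

theorem kind_le {c : ZMod N → Bool} : kind c ≤ 3 := by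
  unfold kind; split_ifs <;> omega

theorem kind_eq_of_not_free {c : ZMod N → Bool} (h : ¬ FirstFree c) :
    (kind c = 3 ↔ Occ c 2 ∧ Occ c 3) ∧ (kind c = 2 ↔ Occ c 2 ∧ ¬ Occ c 3) ∧
      (kind c = 1 ↔ ¬ Occ c 2) := by
  unfold kind; split_ifs <;> simp_all

/-- The site before a pivot is empty. -/
theorem IsPivot.not_occ_pred {c : ZMod N → Bool} (hc : ValidClosed N c) {p : ℕ}
    (hp : IsPivot c p) (h2 : 2 ≤ p) : ¬ Occ c (p - 1) := by
  obtain ⟨hcand, -, hbl⟩ := hp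
  have hf : ¬ FirstFree c := by
    rw [← kind_eq_zero_iff]
    unfold IsCandidate at hcand
    omega
  obtain ⟨k3, k2, k1⟩ := kind_eq_of_not_free hf
  by_cases h8 : IsCandidate N (kind c) (p - 4)
  · obtain ⟨-, h5, h6⟩ := hbl (p - 4) (by omega) h8
    have := hc.not_occ (p - 4 + 1)
    have h4 : 5 ≤ p := by unfold IsCandidate at h8; omega
    rw [show p - 4 + 1 + 2 = p - 1 by omega] at this
    exact fun h => this ⟨h5, h6, h⟩
  · unfold IsCandidate at hcand h8
    rcases hcand with h | h | h | h
    · omega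
    · obtain rfl : p = 5 := by omega
      have := hc.not_occ 2
      have := k3.1 h.1
      tauto
    · obtain rfl : p = 4 := by omega
      exact (k2.1 h.1).2
    · obtain rfl : p = 3 := by omega
      exact k1.1 h.1

theorem IsPivot.kind_toggle (hN : 1 ≤ N) {c : ZMod N → Bool} (hc : ValidClosed N c) {p : ℕ}
    (hp : IsPivot c p) : kind (toggle c p) = kind c := by
  obtain ⟨hp1, hpN⟩ := hp.bounds hN
  have ht := fun i h1 h2 => occ_toggle (c := c) hp1 hpN (i := i) h1 h2
  by_cases hf : FirstFree c
  · rw [kind_eq_zero_iff.2 hf, kind_eq_zero_iff]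
    have hk := hp.1
    rw [kind_eq_zero_iff.2 hf] at hk
    obtain rfl : p = 1 := by unfold IsCandidate at hk; omega
    obtain ⟨h2, ha, hb, hd⟩ := hf
    have t2 := ht 2 (by omega) (by omega)
    have tN := ht N (by omega) (by omega)
    by_cases h3 : N = 2
    · subst h3
      refine ⟨le_rfl, ?_, ?_, ?_⟩ <;> simp_all
    · have t3 := ht 3 (by omega) (by omega)
      have tM := ht (N - 1) (by omega) (by omega)
      rw [if_neg (by omega)] at t2 t3 tN tM
      simp only [FirstFree, t2, t3, tN, tM]
      exact ⟨h2, ha, hb, hd⟩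
  · have hk := hp.1
    obtain ⟨k3, k2, k1⟩ := kind_eq_of_not_free hf
    have k0 := kind_eq_zero_iff.not.2 hf
    have h4 : 3 ≤ p ∧ 4 ≤ N := by unfold IsCandidate at hk; omega
    have t2 := ht 2 (by omega) (by omega)
    have t3 := ht 3 (by omega) (by omega)
    have tN := ht N (by omega) (by omega)
    have tM := ht (N - 1) (by omega) (by omega)
    unfold IsCandidate at hk
    unfold FirstFree at hf
    have hf' : ¬ FirstFree (toggle c p) := by
      unfold FirstFree
      grind
    obtain ⟨k3', k2', k1'⟩ := kind_eq_of_not_free hf'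
    grind

theorem IsPivot.toggle (hN : 1 ≤ N) {c : ZMod N → Bool} (hc : ValidClosed N c) {p : ℕ}
    (hp : IsPivot c p) : IsPivot (toggle c p) p := by
  obtain ⟨hp1, hpN⟩ := hp.bounds hN
  have ht := fun i h1 h2 => occ_toggle (c := c) hp1 hpN (i := i) h1 h2
  unfold IsPivot
  rw [hp.kind_toggle hN hc]
  refine ⟨hp.1, ?_, fun q hq hqc => ?_⟩
  · have hb := hp.2.1
    have hv := hc.not_occ p
    have hoc := ht p hp1 hpN
    rw [if_pos rfl] at hoc
    intro h
    have ho : Occ c p := by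
      by_contra ho
      exact h.1 (hoc.2 ho)
    have hle : ∀ j, Occ (_root_.toggle c p) j → Occ c j := by
      intro j hj
      simp only [Occ, _root_.toggle] at hj ho ⊢
      split_ifs at hj with hjp
      · rwa [hjp]
      · exact hj
    exact hv ⟨ho, hle _ h.2.1, hle _ h.2.2⟩
  · have hb := hp.2.2 q hq hqc
    have hle : 1 ≤ q ∧ q + 4 ≤ p := by
      have := hp.1
      unfold IsCandidate at this hqc
      omega
    unfold IsBlocked at hb ⊢
    rwa [ht q (by omega) (by omega), ht (q + 1) (by omega) (by omega),
      ht (q + 2) (by omega) (by omega), if_neg (by omega), if_neg (by omega), if_neg (by omega)]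

theorem IsPivot.validClosed_toggle (hN : 1 ≤ N) {c : ZMod N → Bool} (hc : ValidClosed N c) {p : ℕ}
    (hp : IsPivot c p) : ValidClosed N (_root_.toggle c p) := by
  by_cases ho : Occ c p
  · rw [toggle_eq_removeAtC ho]
    exact hc.removeAtC _
  obtain ⟨hp1, hpN⟩ := hp.bounds hN
  have ht := fun i h1 h2 => occ_toggle (c := c) hp1 hpN (i := i) h1 h2
  have hpred := hp.not_occ_pred hc
  obtain ⟨hk, hb, -⟩ := hp
  have hff := kind_eq_zero_iff (c := c)
  have hkd := @kind_eq_of_not_free _ c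
  have w1 := occ_add_self c 1
  have w2 := occ_add_self c 2
  have h01 := hc.not_occ (N - 1)
  have h02 := hc.not_occ N
  unfold IsCandidate at hk
  unfold FirstFree at hff hkd
  unfold IsBlocked at hb
  rw [validClosed_iff hN] at hc ⊢
  obtain ⟨hc1, hc2, hc3⟩ := hc
  refine ⟨fun i hi hi2 => ?_, fun h2 => ⟨?_, ?_⟩, ?_⟩
  · have := hc1 i hi hi2
    rw [ht i (by omega) (by omega), ht (i + 1) (by omega) (by omega),
      ht (i + 2) (by omega) (by omega)]
    by_cases hi1 : i = p
    · subst hi1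
      grind
    by_cases hi2 : i + 1 = p
    · subst hi2
      have := hpred (by omega)
      grind
    by_cases hi3 : i + 2 = p
    · subst hi3
      have := hpred (by omega)
      rw [show i + 2 - 1 = i + 1 by omega] at this
      grind
    grind
  · rw [ht 1 (by omega) (by omega), ht N (by omega) (by omega), ht (N - 1) (by omega) (by omega)]
    rw [show N - 1 + 1 = N by omega, show N - 1 + 2 = N + 1 by omega, w1] at h01
    by_cases hp3 : p = 1
    · subst hp3
      grind
    have hpr := hpred (by omega)
    by_cases hpn : p = N
    · subst hpn
      grind
    by_cases hpn : p = N - 1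
    · rw [show p + 1 = N by omega, show p + 2 = N + 1 by omega, w1] at hb
      grind
    grind
  · rw [ht 1 (by omega) (by omega), ht N (by omega) (by omega), ht 2 (by omega) (by omega)]
    rw [w1, w2] at h02
    by_cases hp3 : p = 1
    · subst hp3
      grind
    by_cases hpn : p = N
    · subst hpn
      have := hc1 1 le_rfl
      grind
    grind
  · rintro rfl
    grind

theorem IsPivot.kind_le_kind (hN : 1 ≤ N) {c c' : ZMod N → Bool} {p : ℕ} (hp : IsPivot c p)
    (hv : ValidClosed N c') (hop : Occ c' p)
    (ho : ∀ i, 1 ≤ i → i ≤ N → Occ c' i → i = p ∨ Occ c i) : kind c' ≤ kind c := by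
  by_cases hf' : FirstFree c'
  · rw [kind_eq_zero_iff.2 hf']; omega
  obtain ⟨k3', k2', k1'⟩ := kind_eq_of_not_free hf'
  by_cases hf : FirstFree c
  · exfalso
    have hk := hp.1
    rw [kind_eq_zero_iff.2 hf] at hk
    obtain rfl : p = 1 := by unfold IsCandidate at hk; omega
    refine hf' ⟨hf.1, ?_⟩
    obtain ⟨h1, h2, -⟩ := (validClosed_iff hN).1 hv
    have h1 := h1 1 le_rfl
    have h2N := hf.1
    by_cases hN2 : N = 2
    · subst hN2
      have h2 := (h2 le_rfl).2
      exact ⟨fun h => h2 ⟨h.1, hop, h.1⟩, fun h => h2 ⟨h.1, hop, h.1⟩,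
        fun h => h2 ⟨h.2, hop, h.2⟩⟩
    · have h1 := h1 (by omega)
      have h2 := h2 h2N
      exact ⟨fun h => h1 ⟨hop, h⟩, fun h => h2.2 ⟨h.1, hop, h.2⟩, fun h => h2.1 ⟨h.1, h.2, hop⟩⟩
  · obtain ⟨k3, k2, k1⟩ := kind_eq_of_not_free hf
    have k0 := kind_eq_zero_iff.not.2 hf
    have hk := hp.1
    unfold IsCandidate at hk
    have hle := kind_le (c := c')
    rcases hk with h | h | h | h
    · omega
    · omega
    · have : kind c' ≠ 3 := fun h' => by
        rcases ho 3 (by omega) (by omega) (k3'.1 h').2 with h'' | h''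
        · omega
        · exact (k2.1 h.1).2 h''
      omega
    · have : kind c' = 1 := k1'.2 fun h' => by
        rcases ho 2 (by omega) (by omega) h' with h'' | h''
        · omega
        · exact k1.1 h.1 h''
      omega

/-- A rank with respect to which the matching is acyclic. -/
noncomputable def pivotRank (c : ZMod N → Bool) (p : ℕ) : ℕ := kind c * (N + 1) + p

theorem pivotRank_lt (hN : 1 ≤ N) {c : ZMod N → Bool} (hc : ValidClosed N c) {p : ℕ}
    (hp : IsPivot c p) (hcp : ¬ Occ c p) {x : ℕ} (hx : 1 ≤ x) (hxN : x ≤ N) (hxp : x ≠ p)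
    {p' : ℕ} (hp' : IsPivot (removeAtC (toggle c p) x) p')
    (hcp' : ¬ Occ (removeAtC (toggle c p) x) p') :
    pivotRank (removeAtC (toggle c p) x) p' < pivotRank c p := by
  obtain ⟨hp1, hpN⟩ := hp.bounds hN
  obtain ⟨hp1', hpN'⟩ := hp'.bounds hN
  have hv := (hp.validClosed_toggle hN hc).removeAtC x
  have ho : ∀ i, 1 ≤ i → i ≤ N →
      (Occ (removeAtC (_root_.toggle c p) x) i ↔ i ≠ x ∧ (i = p ∨ Occ c i)) := by
    intro i h1 h2
    rw [occ_removeAtC hx hxN h1 h2, occ_toggle hp1 hpN h1 h2]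
    grind
  generalize removeAtC (_root_.toggle c p) x = c' at *
  have hop : Occ c' p := (ho p hp1 hpN).2 ⟨hxp.symm, Or.inl rfl⟩
  have hkind := hp.kind_le_kind hN hv hop fun i h1 h2 h => ((ho i h1 h2).1 h).2
  unfold pivotRank
  rcases hkind.lt_or_eq with h | h
  · nlinarith
  · have : p' < p := by
      rcases lt_trichotomy p' p with h' | h' | h'
      · exact h'
      · exact absurd hop (h' ▸ hcp')
      · exact absurd hop (hp'.2.2 p h' (h ▸ hp.1)).1
    rw [h]
    omega

end Matching

section Critical

variable {N : ℕ}

/-- The admissible configurations left unmatched. -/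
def IsCritical (c : ZMod N → Bool) : Prop :=
  ValidClosed N c ∧ ∀ p, ¬ IsPivot c p

theorem forall_not_isPivot_iff {c : ZMod N → Bool} :
    (∀ p, ¬ IsPivot c p) ↔ ∀ p, IsCandidate N (kind c) p → IsBlocked c p := by
  constructor
  · intro h p
    induction p using Nat.strong_induction_on with
    | _ p ih =>
      intro hp
      by_contra hb
      exact h p ⟨hp, hb, ih⟩
  · intro h p hp
    exact hp.2.1 (h p hp.1)

/-- The occupied sites of the critical configuration of kind `k`. -/
def CriticalPattern (N k y : ℕ) : Prop :=
  (k = 3 ∧ (y % 4 = 2 ∨ y % 4 = 3)) ∨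
  (k = 2 ∧ (y = 2 ∨ y = N ∨ (4 ≤ y ∧ (y % 4 = 1 ∨ y % 4 = 2)))) ∨
  (k = 1 ∧ 2 ≤ N ∧ (y + 1 = N ∨ y = N ∨ (3 ≤ y ∧ y + 3 ≤ N ∧ (y % 4 = 0 ∨ y % 4 = 1))))

/-- The kinds of the critical configurations on `N` sites. -/
def criticalKinds (N : ℕ) : Finset ℕ := (Finset.Icc 1 3).filter fun k => N % 4 = 0 ∨ N % 4 = k

theorem mem_criticalKinds {k : ℕ} :
    k ∈ criticalKinds N ↔ (1 ≤ k ∧ k ≤ 3) ∧ (N % 4 = 0 ∨ N % 4 = k) := by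
  simp [criticalKinds]

theorem IsCritical.not_firstFree {c : ZMod N → Bool} (hc : IsCritical c) : ¬ FirstFree c := by
  intro hf
  have h1 := forall_not_isPivot_iff.1 hc.2 1 (Or.inl ⟨kind_eq_zero_iff.2 hf, rfl⟩)
  exact hf.2.1 h1.2

theorem IsCritical.pattern_of_kind_three (hN : 1 ≤ N) {c : ZMod N → Bool} (hc : IsCritical c)
    (hk : kind c = 3) : (N % 4 = 0 ∨ N % 4 = 3) ∧
      ∀ y, 1 ≤ y → y ≤ N → (Occ c y ↔ CriticalPattern N 3 y) := by
  obtain ⟨o2, o3⟩ := (kind_eq_of_not_free hc.not_firstFree).1.1 hk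
  have hb := forall_not_isPivot_iff.1 hc.2
  rw [hk] at hb
  have hv := hc.1.not_occ
  have w1 := occ_add_self c 1
  have o1 : ¬ Occ c 1 := fun h => hv 1 ⟨h, o2, o3⟩
  have blocked : ∀ p, p ≤ N → p % 4 = 1 → IsBlocked c p := by
    intro p hp hp4
    by_cases hp1 : p = 1
    · subst hp1
      exact ⟨o1, o2, o3⟩
    · exact hb p (Or.inr (Or.inl ⟨rfl, by omega, hp, hp4⟩))
  have n1 : N % 4 ≠ 1 := fun h => o1 (w1.1 (blocked N le_rfl h).2.1)
  have n2 : N % 4 ≠ 2 := fun h => by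
    have := (blocked (N - 1) (by omega) (by omega)).2.2
    rw [show N - 1 + 2 = N + 1 by omega] at this
    exact o1 (w1.1 this)
  refine ⟨by omega, fun y hy hyN => ?_⟩
  obtain ⟨b0, b1, b2⟩ := blocked (y - (y - 1) % 4) (by omega) (by omega)
  have b3 := hv (y - (y - 1) % 4 + 1)
  unfold CriticalPattern
  generalize hp : y - (y - 1) % 4 = p at *
  obtain h | h | h | h : y = p ∨ y = p + 1 ∨ y = p + 2 ∨ y = p + 3 := by omega
  · rw [h]; exact iff_of_false b0 (by omega)
  · rw [h]; exact iff_of_true b1 (by omega)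
  · rw [h]; exact iff_of_true b2 (by omega)
  · rw [h]
    have : ¬ Occ c (p + 3) := fun h => b3 ⟨b1, b2, h⟩
    exact iff_of_false this (by omega)

theorem IsCritical.pattern_of_kind_two (hN : 1 ≤ N) {c : ZMod N → Bool} (hc : IsCritical c)
    (hk : kind c = 2) : (N % 4 = 0 ∨ N % 4 = 2) ∧
      ∀ y, 1 ≤ y → y ≤ N → (Occ c y ↔ CriticalPattern N 2 y) := by
  have hf := hc.not_firstFree
  obtain ⟨o2, o3⟩ := (kind_eq_of_not_free hf).2.1.1 hk
  have hb := forall_not_isPivot_iff.1 hc.2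
  rw [hk] at hb
  have hv := hc.1.not_occ
  have w1 := occ_add_self c 1
  have w2 := occ_add_self c 2
  have hN2 : 2 ≤ N := by
    by_contra h
    obtain rfl : N = 1 := by omega
    exact o3 (w2.2 o2)
  have oN : Occ c N := by
    by_contra h
    exact hf ⟨hN2, fun h' => o3 h'.2, fun h' => h h'.1, fun h' => h h'.2⟩
  have o1 : ¬ Occ c 1 := fun h => hv N ⟨oN, w1.2 h, w2.2 o2⟩
  have blocked : ∀ p, 4 ≤ p → p + 1 ≤ N → p % 4 = 0 → IsBlocked c p :=
    fun p h4 hp hp4 => hb p (Or.inr (Or.inr (Or.inl ⟨rfl, h4, hp, hp4⟩)))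
  have n1 : N % 4 ≠ 1 := fun h => by
    have := (blocked (N - 1) (by omega) (by omega) (by omega)).2.2
    rw [show N - 1 + 2 = N + 1 by omega] at this
    exact o1 (w1.1 this)
  have n3 : N % 4 ≠ 3 := fun h => by
    by_cases h3 : N = 3
    · subst h3; exact o3 oN
    obtain ⟨-, b1, b2⟩ := blocked (N - 3) (by omega) (by omega) (by omega)
    have := hv (N - 3 + 1)
    rw [show N - 3 + 1 + 2 = N by omega] at this
    exact this ⟨b1, b2, oN⟩
  refine ⟨by omega, fun y hy hyN => ?_⟩
  unfold CriticalPattern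
  by_cases y1 : y = 1
  · subst y1; exact iff_of_false o1 (by omega)
  by_cases y2 : y = 2
  · subst y2; exact iff_of_true o2 (by omega)
  by_cases yN : y = N
  · rw [yN]; exact iff_of_true oN (by omega)
  by_cases y3 : y = 3
  · subst y3; exact iff_of_false o3 (by omega)
  obtain ⟨b0, b1, b2⟩ := blocked (y - y % 4) (by omega) (by omega) (by omega)
  have b3 := hv (y - y % 4 + 1)
  generalize hp : y - y % 4 = p at *
  obtain h | h | h | h : y = p ∨ y = p + 1 ∨ y = p + 2 ∨ y = p + 3 := by omega
  · rw [h]; exact iff_of_false b0 (by omega)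
  · rw [h]; exact iff_of_true b1 (by omega)
  · rw [h]; exact iff_of_true b2 (by omega)
  · rw [h]
    have : ¬ Occ c (p + 3) := fun h => b3 ⟨b1, b2, h⟩
    exact iff_of_false this (by omega)

theorem IsCritical.pattern_of_kind_one (hN : 1 ≤ N) {c : ZMod N → Bool} (hc : IsCritical c)
    (hk : kind c = 1) : (N % 4 = 0 ∨ N % 4 = 1) ∧
      ∀ y, 1 ≤ y → y ≤ N → (Occ c y ↔ CriticalPattern N 1 y) := by
  have hf := hc.not_firstFree
  have o2 := (kind_eq_of_not_free hf).2.2.1 hk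
  have hb := forall_not_isPivot_iff.1 hc.2
  rw [hk] at hb
  have hv := hc.1.not_occ
  have w1 := occ_add_self c 1
  by_cases hN1 : N = 1
  · subst hN1
    refine ⟨by omega, fun y hy hyN => ?_⟩
    obtain rfl : y = 1 := by omega
    have : ¬ Occ c 1 := fun h => o2 (w1.2 h)
    simp [this, CriticalPattern]
  obtain ⟨oM, oN⟩ : Occ c (N - 1) ∧ Occ c N := by
    by_contra h
    exact hf ⟨by omega, fun h' => o2 h'.1, fun h' => o2 h'.2, h⟩
  have hN4 : 4 ≤ N := by
    by_contra h
    obtain rfl | rfl : N = 2 ∨ N = 3 := by omega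
    · exact o2 oN
    · exact o2 oM
  have o1 : ¬ Occ c 1 := fun h => by
    have := hv (N - 1)
    rw [show N - 1 + 1 = N by omega, show N - 1 + 2 = N + 1 by omega, w1] at this
    exact this ⟨oM, oN, h⟩
  have oL : ¬ Occ c (N - 2) := fun h => by
    have := hv (N - 2)
    rw [show N - 2 + 1 = N - 1 by omega, show N - 2 + 2 = N by omega] at this
    exact this ⟨h, oM, oN⟩
  have blocked : ∀ p, p + 3 ≤ N → p % 4 = 3 → IsBlocked c p :=
    fun p hp hp4 => hb p (Or.inr (Or.inr (Or.inr ⟨rfl, by omega, hp, hp4⟩)))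
  have n2 : N % 4 ≠ 2 := fun h => by
    have := (blocked (N - 3) (by omega) (by omega)).2.1
    rw [show N - 3 + 1 = N - 2 by omega] at this
    exact oL this
  have n3 : N % 4 ≠ 3 := fun h => by
    have := (blocked (N - 4) (by omega) (by omega)).2.2
    rw [show N - 4 + 2 = N - 2 by omega] at this
    exact oL this
  refine ⟨by omega, fun y hy hyN => ?_⟩
  unfold CriticalPattern
  by_cases y1 : y = 1
  · subst y1; exact iff_of_false o1 (by omega)
  by_cases y2 : y = 2
  · subst y2; exact iff_of_false o2 (by omega)
  by_cases yN : y = N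
  · rw [yN]; exact iff_of_true oN (by omega)
  by_cases yM : y = N - 1
  · rw [yM]; exact iff_of_true oM (by omega)
  by_cases yL : y = N - 2
  · rw [yL]; exact iff_of_false oL (by omega)
  obtain ⟨b0, b1, b2⟩ := blocked (y - (y + 1) % 4) (by omega) (by omega)
  have b3 := hv (y - (y + 1) % 4 + 1)
  have hp3 : 3 ≤ y - (y + 1) % 4 := by omega
  generalize hp : y - (y + 1) % 4 = p at *
  obtain h | h | h | h : y = p ∨ y = p + 1 ∨ y = p + 2 ∨ y = p + 3 := by omega
  · rw [h]; exact iff_of_false b0 (by omega)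
  · rw [h]; exact iff_of_true b1 (by omega)
  · rw [h]; exact iff_of_true b2 (by omega)
  · rw [h]
    have : ¬ Occ c (p + 3) := fun h => b3 ⟨b1, b2, h⟩
    exact iff_of_false this (by omega)

theorem isCritical_of_pattern (hN : 1 ≤ N) {c : ZMod N → Bool} {k : ℕ}
    (hk : k ∈ criticalKinds N)
    (h : ∀ y, 1 ≤ y → y ≤ N → (Occ c y ↔ CriticalPattern N k y)) :
    IsCritical c ∧ kind c = k := by
  rw [mem_criticalKinds] at hk
  have hv : ValidClosed N c := by
    rw [validClosed_iff hN]
    refine ⟨fun i hi hi2 => ?_, fun h2 => ⟨?_, ?_⟩, fun h1 => ?_⟩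
    · rw [h i (by omega) (by omega), h (i + 1) (by omega) (by omega),
        h (i + 2) (by omega) (by omega)]
      unfold CriticalPattern
      omega
    · rw [h 1 (by omega) (by omega), h (N - 1) (by omega) (by omega), h N (by omega) (by omega)]
      unfold CriticalPattern
      omega
    · rw [h 1 (by omega) (by omega), h 2 (by omega) (by omega), h N (by omega) (by omega)]
      unfold CriticalPattern
      omega
    · rw [h 1 (by omega) (by omega)]
      unfold CriticalPattern
      omega
  have w1 := occ_add_self c 1
  have hkind : kind c = k := by
    obtain rfl | rfl | rfl : k = 1 ∨ k = 2 ∨ k = 3 := by omega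
    · by_cases hN1 : N = 1
      · subst hN1
        have hf : ¬ FirstFree c := fun h' => absurd h'.1 (by omega)
        have o1 := (h 1 le_rfl le_rfl).not.2 (by unfold CriticalPattern; omega)
        exact (kind_eq_of_not_free hf).2.2.2 (w1.not.2 o1)
      · have o2 := (h 2 (by omega) (by omega)).not.2 (by unfold CriticalPattern; omega)
        have oN := (h N (by omega) (by omega)).2 (by unfold CriticalPattern; omega)
        have oM := (h (N - 1) (by omega) (by omega)).2 (by unfold CriticalPattern; omega)
        have hf : ¬ FirstFree c := fun h' => h'.2.2.2 ⟨oM, oN⟩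
        exact (kind_eq_of_not_free hf).2.2.2 o2
    · have o2 := (h 2 (by omega) (by omega)).2 (by unfold CriticalPattern; omega)
      have oN := (h N (by omega) (by omega)).2 (by unfold CriticalPattern; omega)
      have hf : ¬ FirstFree c := fun h' => h'.2.2.1 ⟨oN, o2⟩
      refine (kind_eq_of_not_free hf).2.1.2 ⟨o2, ?_⟩
      by_cases hN2 : N = 2
      · subst hN2
        exact w1.not.2 ((h 1 (by omega) (by omega)).not.2 (by unfold CriticalPattern; omega))
      · exact (h 3 (by omega) (by omega)).not.2 (by unfold CriticalPattern; omega)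
    · have o2 := (h 2 (by omega) (by omega)).2 (by unfold CriticalPattern; omega)
      have o3 := (h 3 (by omega) (by omega)).2 (by unfold CriticalPattern; omega)
      have hf : ¬ FirstFree c := fun h' => h'.2.1 ⟨o2, o3⟩
      exact (kind_eq_of_not_free hf).1.2 ⟨o2, o3⟩
  refine ⟨⟨hv, forall_not_isPivot_iff.2 fun p hp => ?_⟩, hkind⟩
  rw [hkind] at hp
  have hle : 3 ≤ p ∧ p + 2 ≤ N := by unfold IsCandidate at hp; omega
  unfold IsBlocked
  rw [h p (by omega) (by omega), h (p + 1) (by omega) (by omega), h (p + 2) (by omega) (by omega)]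
  unfold IsCandidate at hp
  unfold CriticalPattern
  omega

theorem isCritical_iff (hN : 1 ≤ N) {c : ZMod N → Bool} :
    IsCritical c ↔ ∃ k ∈ criticalKinds N,
      ∀ y, 1 ≤ y → y ≤ N → (Occ c y ↔ CriticalPattern N k y) := by
  refine ⟨fun hc => ⟨kind c, ?_⟩, fun ⟨k, hk, h⟩ => (isCritical_of_pattern hN hk h).1⟩
  have h0 : kind c ≠ 0 := kind_eq_zero_iff.not.2 hc.not_firstFree
  have h3 := kind_le (c := c)
  obtain h | h | h : kind c = 1 ∨ kind c = 2 ∨ kind c = 3 := by omega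
  · have := hc.pattern_of_kind_one hN h
    rw [h, mem_criticalKinds]
    exact ⟨by omega, this.2⟩
  · have := hc.pattern_of_kind_two hN h
    rw [h, mem_criticalKinds]
    exact ⟨by omega, this.2⟩
  · have := hc.pattern_of_kind_three hN h
    rw [h, mem_criticalKinds]
    exact ⟨by omega, this.2⟩

/-- The fermion number is the final value of any function counting the occupied sites. -/
theorem fcountClosed_eq_of_step {c : ZMod N → Bool} (G : ℕ → ℕ) (h0 : G 0 = 0)
    (hocc : ∀ i < N, Occ c (i + 1) → G (i + 1) = G i + 1)
    (hemp : ∀ i < N, ¬ Occ c (i + 1) → G (i + 1) = G i) : fcountClosed N c = G N := by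
  classical
  have key : ∀ M ≤ N, (∑ i ∈ Finset.range M, if Occ c (i + 1) then 1 else 0) = G M := by
    intro M
    induction M with
    | zero => intro _; rw [h0]; rfl
    | succ M ih =>
      intro hM
      rw [Finset.sum_range_succ, ih (by omega)]
      split_ifs with h
      · exact (hocc M hM h).symm
      · exact (hemp M hM h).symm
  rw [fcountClosed_eq_sum, key N le_rfl]

theorem IsCritical.fcountClosed_eq (hN : 1 ≤ N) {c : ZMod N → Bool} (hc : IsCritical c) :
    fcountClosed N c = 2 * (N / 4) + (N % 4 - 1) := by
  obtain ⟨k, hk, h⟩ := (isCritical_iff hN).1 hc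
  rw [mem_criticalKinds] at hk
  unfold CriticalPattern at h
  obtain rfl | rfl | rfl : k = 1 ∨ k = 2 ∨ k = 3 := by omega
  · rw [fcountClosed_eq_of_step
      (fun M => M / 4 + (M + 3) / 4 - 1 + if N % 4 = 0 ∧ N ≤ M + 1 then 1 else 0)]
    · grind
    · grind
    · intro i hi ho
      rw [h _ (by omega) (by omega)] at ho
      split_ifs <;> omega
    · intro i hi ho
      rw [h _ (by omega) (by omega)] at ho
      split_ifs <;> omega
  · rw [fcountClosed_eq_of_step
      (fun M => (M + 3) / 4 + (M + 2) / 4 - 1 + if N % 4 = 0 ∧ N ≤ M then 1 else 0)]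
    · grind
    · grind
    · intro i hi ho
      rw [h _ (by omega) (by omega)] at ho
      split_ifs <;> omega
    · intro i hi ho
      rw [h _ (by omega) (by omega)] at ho
      split_ifs <;> omega
  · rw [fcountClosed_eq_of_step (fun M => (M + 2) / 4 + (M + 1) / 4)]
    · omega
    · rfl
    · intro i hi ho
      rw [h _ (by omega) (by omega)] at ho
      omega
    · intro i hi ho
      rw [h _ (by omega) (by omega)] at ho
      omega

/-- The configuration whose occupied sites in `1, …, N` are those satisfying `P`. -/
noncomputable def ofPattern (N : ℕ) (P : ℕ → Prop) : ZMod N → Bool :=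
  open Classical in fun z => decide (∃ i, 1 ≤ i ∧ i ≤ N ∧ (i : ZMod N) = z ∧ P i)

theorem occ_ofPattern {P : ℕ → Prop} {y : ℕ} (hy : 1 ≤ y) (hyN : y ≤ N) :
    Occ (ofPattern N P) y ↔ P y := by
  simp only [Occ, ofPattern, decide_eq_true_eq]
  constructor
  · rintro ⟨i, hi, hiN, h, hP⟩
    rwa [← (natCast_zmod_eq_iff hi hiN hy hyN).1 h]
  · exact fun h => ⟨y, hy, hyN, rfl, h⟩

theorem ncard_isCritical (hN : 1 ≤ N) :
    {c : ZMod N → Bool | IsCritical c}.ncard = if N % 4 = 0 then 3 else 1 := by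
  have himage : {c : ZMod N → Bool | IsCritical c} =
      (fun k => ofPattern N (CriticalPattern N k)) '' (criticalKinds N : Set ℕ) := by
    ext c
    simp only [Set.mem_ofPred_eq, Set.mem_image, isCritical_iff hN, Finset.mem_coe]
    refine exists_congr fun k => and_congr_right fun _ => ⟨fun h => ?_, ?_⟩
    · exact occ_ext hN fun i hi hiN => (occ_ofPattern hi hiN).trans (h i hi hiN).symm
    · rintro rfl y hy hyN
      exact occ_ofPattern hy hyN
  have hinj : Set.InjOn (fun k => ofPattern N (CriticalPattern N k)) (criticalKinds N : Set ℕ) := by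
    intro k hk l hl hkl
    rw [← (isCritical_of_pattern hN hk fun y hy hyN => occ_ofPattern hy hyN).2,
      ← (isCritical_of_pattern hN hl fun y hy hyN => occ_ofPattern hy hyN).2]
    exact congrArg kind hkl
  rw [himage, hinj.ncard_image, Set.ncard_coe_finset]
  unfold criticalKinds
  obtain h | h | h | h : N % 4 = 0 ∨ N % 4 = 1 ∨ N % 4 = 2 ∨ N % 4 = 3 := by omega
  all_goals rw [h]; rfl

end Critical

section Supercharge

variable {N : ℕ}

theorem signClosed_ne_zero (c : ZMod N → Bool) (x : ℕ) : signClosed N c x ≠ 0 :=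
  pow_ne_zero _ (by norm_num)

theorem ampClosed_ne_zero {lam mu : ZMod N → ℝ} (hlam : ∀ x, 0 < lam x) (hmu : ∀ x, 0 < mu x)
    (c : ZMod N → Bool) (x : ZMod N) : ampClosed lam mu c x ≠ 0 := by
  unfold ampClosed
  split_ifs <;> norm_cast
  · exact (mul_pos (hlam _) (hmu _)).ne'
  · exact (mul_pos (hlam _) (hmu _)).ne'
  · exact (hlam _).ne'

theorem removeAtC_comm (c : ZMod N → Bool) (x y : ZMod N) :
    removeAtC (removeAtC c x) y = removeAtC (removeAtC c y) x := by
  ext z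
  simp only [removeAtC]
  grind

theorem ampClosed_mul_ampClosed_removeAtC (lam mu : ZMod N → ℝ) {c : ZMod N → Bool}
    (hc : ValidClosed N c) {x y : ZMod N} (hx : c x = true) (hy : c y = true) (hxy : x ≠ y) :
    ampClosed lam mu c x * ampClosed lam mu (removeAtC c x) y =
      ampClosed lam mu c y * ampClosed lam mu (removeAtC c y) x := by
  have adjacent : ∀ x : ZMod N, c x = true → c (x + 1) = true →
      ampClosed lam mu c x * ampClosed lam mu (removeAtC c x) (x + 1) =
        ampClosed lam mu c (x + 1) * ampClosed lam mu (removeAtC c (x + 1)) x := by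
    intro x hx hx1
    have h1 := hc x
    have h2 := hc (x - 1)
    rw [show x - 1 + 1 = x by ring, show x - 1 + 2 = x + 1 by ring] at h2
    have e2 : c (x + 2) = false := by grind
    have e3 : c (x - 1) = false := by grind
    simp only [ampClosed, removeAtC, add_sub_cancel_right, add_assoc, one_add_one_eq_two, hx, hx1,
      e2, e3]
    simp
    ring
  by_cases h1 : y = x + 1
  · subst h1; exact adjacent x hx hy
  by_cases h2 : x = y + 1
  · subst h2; exact (adjacent y hy hx).symm
  have h3 : x - 1 ≠ y := fun h => h2 (by rw [← h]; ring)
  have h4 : y - 1 ≠ x := fun h => h1 (by rw [← h]; ring)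
  have e1 : ampClosed lam mu (removeAtC c x) y = ampClosed lam mu c y := by
    simp only [ampClosed, removeAtC, if_neg (Ne.symm h2), if_neg h4]
  have e2 : ampClosed lam mu (removeAtC c y) x = ampClosed lam mu c x := by
    simp only [ampClosed, removeAtC, if_neg (Ne.symm h1), if_neg h3]
  rw [e1, e2, mul_comm]

theorem signClosed_mul_signClosed_removeAtC {c : ZMod N → Bool} {x y : ℕ} (hx : 1 ≤ x)
    (hxN : x ≤ N) (hy : 1 ≤ y) (hyN : y ≤ N) (hcx : Occ c x) (hcy : Occ c y) (hxy : x ≠ y) :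
    signClosed N c x * signClosed N (removeAtC c x) y =
      -(signClosed N c y * signClosed N (removeAtC c y) x) := by
  have ordered : ∀ {x y : ℕ}, 1 ≤ x → y ≤ N → Occ c x → x < y →
      signClosed N c x * signClosed N (removeAtC c x) y =
        -(signClosed N c y * signClosed N (removeAtC c y) x) := by
    intro x y hx hyN hcx hlt
    have h1 : signClosed N (removeAtC c y) x = signClosed N c x := by
      unfold signClosed
      congr 2
      refine Finset.filter_congr fun i hi => ?_
      rw [Finset.mem_Ico] at hi
      have := occ_removeAtC (c := c) (p := y) (i := i) (by omega) hyN (by omega) (by omega)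
      exact this.trans (and_iff_right (by omega))
    have h2 : signClosed N c y = -signClosed N (removeAtC c x) y := by
      unfold signClosed
      rw [← Finset.card_erase_add_one
        (show x ∈ (Finset.Ico 1 y).filter (fun i : ℕ => c (i : ZMod N) = true) by
          simpa using ⟨⟨hx, hlt⟩, hcx⟩), pow_succ, mul_neg_one]
      congr 3
      ext i
      simp only [Finset.mem_filter, Finset.mem_Ico, Finset.mem_erase]
      have := fun h1 h2 => occ_removeAtC (c := c) (p := x) hx (by omega) (i := i) h1 h2
      simp only [Occ] at this
      grind
    rw [h1, h2]
    ring
  rcases hxy.lt_or_gt with h | h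
  · exact ordered hx hyN hcx h
  · rw [ordered hy hxN hcy h, neg_neg]

/-- The admissible configurations with `g` particles. -/
def cells (N : ℕ) (g : ℤ) : Set (ZMod N → Bool) :=
  {c | ValidClosed N c ∧ (fcountClosed N c : ℤ) = g}

/-- The admissible configurations with `g` particles whose pivot site is empty. -/
def lowerCells (N : ℕ) (g : ℤ) : Set (ZMod N → Bool) :=
  {c | c ∈ cells N g ∧ ∃ p, IsPivot c p ∧ ¬ Occ c p}

/-- The critical configurations with `g` particles. -/
def criticalCells (N : ℕ) (g : ℤ) : Set (ZMod N → Bool) :=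
  {c | IsCritical c ∧ (fcountClosed N c : ℤ) = g}

open Classical in
/-- The pivot site of a configuration, or `0` if there is none. -/
noncomputable def pivot (c : ZMod N → Bool) : ℕ :=
  if h : ∃ p, IsPivot c p then h.choose else 0

theorem IsPivot.pivot_eq {c : ZMod N → Bool} {p : ℕ} (hp : IsPivot c p) : pivot c = p := by
  have h : ∃ p, IsPivot c p := ⟨p, hp⟩
  rw [pivot, dif_pos h]
  exact h.choose_spec.unique hp

theorem ncard_cells (hN : 1 ≤ N) (g : ℤ) :
    (cells N g).ncard =
      (lowerCells N g).ncard + (lowerCells N (g - 1)).ncard + (criticalCells N g).ncard := by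
  have : NeZero N := ⟨by omega⟩
  let f : (ZMod N → Bool) → (ZMod N → Bool) := fun c => toggle c (pivot c)
  have hinj : Set.InjOn f (lowerCells N (g - 1)) := by
    rintro c ⟨⟨hv, -⟩, p, hp, -⟩ c' ⟨⟨hv', -⟩, p', hp', -⟩ h
    simp only [f, hp.pivot_eq, hp'.pivot_eq] at h
    have h1 := hp.toggle hN hv
    rw [h] at h1
    have hpp := h1.unique (hp'.toggle hN hv')
    rw [← toggle_toggle c p, h, hpp, toggle_toggle]
  have himage : f '' lowerCells N (g - 1) =
      {c | c ∈ cells N g ∧ ∃ p, IsPivot c p ∧ Occ c p} := by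
    ext c
    constructor
    · rintro ⟨c, ⟨⟨hv, hg⟩, p, hp, ho⟩, rfl⟩
      have hb := hp.bounds hN
      simp only [f, hp.pivot_eq]
      refine ⟨⟨hp.validClosed_toggle hN hv, ?_⟩, p, hp.toggle hN hv, ?_⟩
      · rw [fcountClosed_toggle hb.1 hb.2 ho]
        push_cast
        omega
      · rw [occ_toggle hb.1 hb.2 hb.1 hb.2, if_pos rfl]
        exact ho
    · rintro ⟨⟨hv, hg⟩, p, hp, ho⟩
      have hb := hp.bounds hN
      have hp' := hp.toggle hN hv
      refine ⟨toggle c p, ⟨⟨hp.validClosed_toggle hN hv, ?_⟩, p, hp', ?_⟩, ?_⟩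
      · rw [toggle_eq_removeAtC ho]
        have := fcountClosed_removeAtC hb.1 hb.2 ho
        omega
      · rw [occ_toggle hb.1 hb.2 hb.1 hb.2, if_pos rfl]
        exact not_not.2 ho
      · simp only [f, hp'.pivot_eq, toggle_toggle]
  have hunion : cells N g =
      (lowerCells N g ∪ f '' lowerCells N (g - 1)) ∪ criticalCells N g := by
    rw [himage]
    ext c
    simp only [Set.mem_union, lowerCells, criticalCells, IsCritical, cells, Set.mem_ofPred_eq,
      ← not_exists]
    constructor
    · rintro ⟨hv, hg⟩
      by_cases h : ∃ p, IsPivot c p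
      · obtain ⟨p, hp⟩ := h
        by_cases ho : Occ c p
        · exact Or.inl (Or.inr ⟨⟨hv, hg⟩, p, hp, ho⟩)
        · exact Or.inl (Or.inl ⟨⟨hv, hg⟩, p, hp, ho⟩)
      · exact Or.inr ⟨⟨hv, h⟩, hg⟩
    · rintro ((h | h) | h)
      · exact h.1
      · exact h.1
      · exact ⟨h.1.1, h.2⟩
  rw [hunion, Set.ncard_union_eq, Set.ncard_union_eq, hinj.ncard_image]
  · rw [himage, Set.disjoint_left]
    rintro c ⟨-, p, hp, ho⟩ ⟨-, p', hp', ho'⟩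
    exact ho (hp.unique hp' ▸ ho')
  · rw [himage, Set.disjoint_left]
    rintro c (⟨-, p, hp, -⟩ | ⟨-, p, hp, -⟩) h
    · exact h.1.2 p hp
    · exact h.1.2 p hp

variable {lam mu : ZMod N → ℝ} {Qbar : ((ZMod N → Bool) → ℂ) →ₗ[ℂ] ((ZMod N → Bool) → ℂ)}

theorem supercharge_comp_self
    (hQbar : ∀ ψ c, ValidClosed N c →
      Qbar ψ c = ∑ x ∈ (Finset.Icc 1 N).filter (fun x : ℕ => c (x : ZMod N) = true),
        signClosed N c x * ampClosed lam mu c (x : ZMod N) * ψ (removeAtC c (x : ZMod N)))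
    (hQbar0 : ∀ ψ c, ¬ ValidClosed N c → Qbar ψ c = 0) (ψ : (ZMod N → Bool) → ℂ) :
    Qbar (Qbar ψ) = 0 := by
  ext c
  by_cases hc : ValidClosed N c
  swap
  · exact hQbar0 _ _ hc
  let F := (Finset.Icc 1 N).filter (fun x : ℕ => c (x : ZMod N) = true)
  let G : ℕ → ℕ → ℂ := fun x y => if x = y then 0 else
    signClosed N c x * ampClosed lam mu c x * (signClosed N (removeAtC c x) y *
      ampClosed lam mu (removeAtC c x) y * ψ (removeAtC (removeAtC c x) y))
  have hG : ∀ x ∈ F, ∀ y ∈ F, G x y = -G y x := by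
    intro x hx y hy
    simp only [F, Finset.mem_filter, Finset.mem_Icc] at hx hy
    by_cases hxy : x = y
    · simp [G, hxy]
    · have ha := ampClosed_mul_ampClosed_removeAtC lam mu hc hx.2 hy.2
        ((natCast_zmod_eq_iff hx.1.1 hx.1.2 hy.1.1 hy.1.2).not.2 hxy)
      have hs := signClosed_mul_signClosed_removeAtC hx.1.1 hx.1.2 hy.1.1 hy.1.2 hx.2 hy.2 hxy
      simp only [G, if_neg hxy, if_neg (Ne.symm hxy)]
      rw [removeAtC_comm c y x]
      linear_combination ψ (removeAtC (removeAtC c x) y) *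
        (ampClosed lam mu c x * ampClosed lam mu (removeAtC c x) y * hs -
          signClosed N c y * signClosed N (removeAtC c y) x * ha)
  have hsum : Qbar (Qbar ψ) c = ∑ x ∈ F, ∑ y ∈ F, G x y := by
    rw [hQbar _ _ hc]
    refine Finset.sum_congr rfl fun x hx => ?_
    simp only [F, Finset.mem_filter, Finset.mem_Icc] at hx
    rw [hQbar _ _ (hc.removeAtC _), Finset.mul_sum]
    have hfilter : (Finset.Icc 1 N).filter
        (fun y : ℕ => removeAtC c (x : ZMod N) (y : ZMod N) = true) = F.erase x := by
      ext y
      simp only [F, Finset.mem_filter, Finset.mem_Icc, Finset.mem_erase]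
      have := fun h1 h2 => occ_removeAtC (c := c) hx.1.1 hx.1.2 (i := y) h1 h2
      simp only [Occ] at this
      grind
    rw [hfilter]
    refine Finset.sum_subset_zero_on_sdiff (Finset.erase_subset _ _) ?_ ?_
    · intro y hy
      simp only [Finset.mem_sdiff, Finset.mem_erase, not_and, ne_eq] at hy
      have : x = y := by
        by_contra h
        exact hy.2 (Ne.symm h) hy.1
      simp [G, this]
    · intro y hy
      simp [G, (Finset.ne_of_mem_erase hy).symm]
  have hneg : ∑ x ∈ F, ∑ y ∈ F, G x y = -∑ x ∈ F, ∑ y ∈ F, G x y := by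
    conv_lhs => rw [Finset.sum_comm]
    rw [← Finset.sum_neg_distrib]
    refine Finset.sum_congr rfl fun x hx => ?_
    rw [← Finset.sum_neg_distrib]
    exact Finset.sum_congr rfl fun y hy => hG y hy x hx
  rw [hsum, Pi.zero_apply]
  exact self_eq_neg.1 hneg

theorem map_supercharge_le
    (hQbar : ∀ ψ c, ValidClosed N c →
      Qbar ψ c = ∑ x ∈ (Finset.Icc 1 N).filter (fun x : ℕ => c (x : ZMod N) = true),
        signClosed N c x * ampClosed lam mu c (x : ZMod N) * ψ (removeAtC c (x : ZMod N)))
    (hQbar0 : ∀ ψ c, ¬ ValidClosed N c → Qbar ψ c = 0) (g : ℤ) :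
    (supportedOn ℂ (cells N g)).map Qbar ≤
      LinearMap.ker Qbar ⊓ supportedOn ℂ (cells N (g + 1)) := by
  rintro _ ⟨ψ, hψ, rfl⟩
  refine ⟨supercharge_comp_self hQbar hQbar0 ψ, fun c hc => ?_⟩
  have hv : ValidClosed N c := by
    by_contra h
    exact hc (hQbar0 _ _ h)
  rw [hQbar _ _ hv] at hc
  obtain ⟨x, hx, hne⟩ := Finset.exists_ne_zero_of_sum_ne_zero hc
  simp only [Finset.mem_filter, Finset.mem_Icc] at hx
  have hcell := hψ _ (right_ne_zero_of_mul hne)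
  have hcount := fcountClosed_removeAtC hx.1.1 hx.1.2 hx.2
  have hg := hcell.2
  exact ⟨hv, by omega⟩

theorem ncard_lowerCells_le (hN : 1 ≤ N) (hlam : ∀ x, 0 < lam x) (hmu : ∀ x, 0 < mu x)
    (hQbar : ∀ ψ c, ValidClosed N c →
      Qbar ψ c = ∑ x ∈ (Finset.Icc 1 N).filter (fun x : ℕ => c (x : ZMod N) = true),
        signClosed N c x * ampClosed lam mu c (x : ZMod N) * ψ (removeAtC c (x : ZMod N)))
    (g : ℤ) :
    (lowerCells N g).ncard ≤ Module.finrank ℂ ((supportedOn ℂ (cells N g)).map Qbar) := by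
  have : NeZero N := ⟨by omega⟩
  refine ncard_le_finrank_map_of_triangular Qbar (fun c hc => hc.1)
    (fun c => toggle c (pivot c)) (fun c => pivotRank c (pivot c)) ?_
  rintro ψ hψ c ⟨⟨hv, -⟩, p, hp, ho⟩ hlow hzero
  have hb := hp.bounds hN
  simp only [hp.pivot_eq] at hlow hzero
  rw [hQbar _ _ (hp.validClosed_toggle hN hv), Finset.sum_eq_single p, removeAtC_toggle ho] at hzero
  · rcases mul_eq_zero.1 hzero with h | h
    · exact absurd h (mul_ne_zero (signClosed_ne_zero _ _) (ampClosed_ne_zero hlam hmu _ _))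
    · exact h
  · intro x hx hxp
    simp only [Finset.mem_filter, Finset.mem_Icc] at hx
    by_contra hne
    have hne' := right_ne_zero_of_mul hne
    have hL : removeAtC (toggle c p) (x : ZMod N) ∈ lowerCells N g := hψ _ hne'
    obtain ⟨p', hp', ho'⟩ := hL.2
    refine hne' (hlow _ hL ?_)
    rw [hp'.pivot_eq]
    exact pivotRank_lt hN hv hp ho hx.1.1 hx.1.2 hxp hp' ho'
  · intro h
    refine absurd ?_ h
    simp only [Finset.mem_filter, Finset.mem_Icc]
    refine ⟨hb, ?_⟩
    have := occ_toggle (c := c) hb.1 hb.2 hb.1 hb.2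
    rw [if_pos rfl] at this
    exact this.2 ho

theorem criticalCells_eq (hN : 1 ≤ N) (g : ℤ) :
    criticalCells N g =
      if g = ((2 * (N / 4) + (N % 4 - 1) : ℕ) : ℤ) then {c | IsCritical c} else ∅ := by
  ext c
  split_ifs with h
  · exact ⟨fun hc => hc.1, fun hc => ⟨hc, by rw [h, IsCritical.fcountClosed_eq hN hc]⟩⟩
  · refine iff_of_false (fun hc => h ?_) (Set.notMem_empty c)
    rw [← hc.2, hc.1.fcountClosed_eq hN]

theorem finrank_cohomology_supercharge (hN : 1 ≤ N) (hlam : ∀ x, 0 < lam x)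
    (hmu : ∀ x, 0 < mu x)
    (hQbar : ∀ ψ c, ValidClosed N c →
      Qbar ψ c = ∑ x ∈ (Finset.Icc 1 N).filter (fun x : ℕ => c (x : ZMod N) = true),
        signClosed N c x * ampClosed lam mu c (x : ZMod N) * ψ (removeAtC c (x : ZMod N)))
    (hQbar0 : ∀ ψ c, ¬ ValidClosed N c → Qbar ψ c = 0) (f : ℕ) :
    Module.finrank ℂ
        (↥(LinearMap.ker Qbar ⊓ gradeClosed N (f : ℤ)) ⧸
          Submodule.comap (LinearMap.ker Qbar ⊓ gradeClosed N (f : ℤ)).subtype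
            (Submodule.map Qbar (gradeClosed N ((f : ℤ) - 1)))) =
      if f = 2 * (N / 4) + (N % 4 - 1) then (if N % 4 = 0 then 3 else 1) else 0 := by
  have : NeZero N := ⟨by omega⟩
  refine (finrank_cohomology_eq_ncard_critical Qbar (cells N) (lowerCells N) (criticalCells N)
    (map_supercharge_le hQbar hQbar0) (ncard_cells hN)
    (ncard_lowerCells_le hN hlam hmu hQbar) ((2 * (N / 4) + (N % 4 - 1) : ℕ) : ℤ)
    (fun g hg => by rw [criticalCells_eq hN, if_neg hg]) f).trans ?_
  rw [criticalCells_eq hN, ← ncard_isCritical hN]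
  simp only [Nat.cast_inj]
  split_ifs with h
  · rfl
  · exact Set.ncard_empty _

end Supercharge

/-- for the closed (periodic) M₂ chain of `N` sites with positive weights,
the cohomology of the raising supercharge `Q̄₊` at fermion number `f` has dimension `3`
if `N = 4n, f = 2n`; dimension `1` if `N = 4n+1, f = 2n`, or `N = 4n+2, f = 2n+1`, or
`N = 4n+3, f = 2n+2`; and dimension `0` for all other pairs `(N, f)`. -/
theorem stmt1 (N : ℕ) (hN : 1 ≤ N) (lam mu : ZMod N → ℝ)
    (hlam : ∀ x, 0 < lam x) (hmu : ∀ x, 0 < mu x)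
    (Qbar : ((ZMod N → Bool) → ℂ) →ₗ[ℂ] ((ZMod N → Bool) → ℂ))
    (hQbar : ∀ ψ c, ValidClosed N c →
      Qbar ψ c = ∑ x ∈ (Finset.Icc 1 N).filter (fun x : ℕ => c (x : ZMod N) = true),
        signClosed N c x * ampClosed lam mu c (x : ZMod N) * ψ (removeAtC c (x : ZMod N)))
    (hQbar0 : ∀ ψ c, ¬ ValidClosed N c → Qbar ψ c = 0)
    (f : ℕ) :
    ((∃ n : ℕ, N = 4 * n ∧ f = 2 * n) →
      Module.finrank ℂ
        (↥(LinearMap.ker Qbar ⊓ gradeClosed N (f : ℤ)) ⧸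
          Submodule.comap (LinearMap.ker Qbar ⊓ gradeClosed N (f : ℤ)).subtype
            (Submodule.map Qbar (gradeClosed N ((f : ℤ) - 1)))) = 3) ∧
    ((∃ n : ℕ, (N = 4 * n + 1 ∧ f = 2 * n) ∨ (N = 4 * n + 2 ∧ f = 2 * n + 1) ∨
        (N = 4 * n + 3 ∧ f = 2 * n + 2)) →
      Module.finrank ℂ
        (↥(LinearMap.ker Qbar ⊓ gradeClosed N (f : ℤ)) ⧸
          Submodule.comap (LinearMap.ker Qbar ⊓ gradeClosed N (f : ℤ)).subtype
            (Submodule.map Qbar (gradeClosed N ((f : ℤ) - 1)))) = 1) ∧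
    (¬(∃ n : ℕ, N = 4 * n ∧ f = 2 * n) →
      ¬(∃ n : ℕ, (N = 4 * n + 1 ∧ f = 2 * n) ∨ (N = 4 * n + 2 ∧ f = 2 * n + 1) ∨
        (N = 4 * n + 3 ∧ f = 2 * n + 2)) →
      Module.finrank ℂ
        (↥(LinearMap.ker Qbar ⊓ gradeClosed N (f : ℤ)) ⧸
          Submodule.comap (LinearMap.ker Qbar ⊓ gradeClosed N (f : ℤ)).subtype
            (Submodule.map Qbar (gradeClosed N ((f : ℤ) - 1)))) = 0) := by
  rw [finrank_cohomology_supercharge hN hlam hmu hQbar hQbar0]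
  refine ⟨?_, ?_, fun h1 h2 => ?_⟩
  · rintro ⟨n, rfl, rfl⟩
    rw [if_pos (by omega), if_pos (by omega)]
  · rintro ⟨n, ⟨rfl, rfl⟩ | ⟨rfl, rfl⟩ | ⟨rfl, rfl⟩⟩ <;>
      rw [if_pos (by omega), if_neg (by omega)]
  · rw [if_neg fun h => ?_]
    obtain h' | h' : N % 4 = 0 ∨ N % 4 ≠ 0 := by omega
    · exact h1 ⟨N / 4, by omega, by omega⟩
    · exact h2 ⟨N / 4, by omega⟩
end

section
/- Fix 0 < q < 1, θ = π/4, and t ∈ ℝ. Define for each integer x: μ_x² = (θ1(θ)/θ1(2θ))² · θ4(t+2xθ)² / (θ4(t+(2x−1)θ) · θ4(t+(2x+1)θ)) and λ_x² = 2 (θ1(θ)/θ1(2θ))² · θ4(t+(2x−1)θ)² / (θ4(t+2(x−1)θ) · θ4(t+2xθ)). Then for every integer x one has μ_x² + μ_{x+1}² = 1 and λ_x² + λ_{x+1}² = 2. Equivalently, for every a ∈ ℂ at which the denominators are nonzero, (θ1(θ)/θ1(2θ))² · [ θ4(a)²/(θ4(a−θ)θ4(a+θ)) + θ4(a+2θ)²/(θ4(a+θ)θ4(a+3θ))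 ] = 1. -/
/-- The Jacobi theta function `θ₁(u,q) = −i Σ_{j∈ℤ} (−1)^j q^{(j+1/2)²} e^{(2j+1)iu}`. -/
noncomputable def th1 (q u : ℂ) : ℂ :=
  -Complex.I * ∑' j : ℤ, (-1 : ℂ) ^ j * q ^ (((j : ℂ) + 1 / 2) ^ 2) *
    Complex.exp ((2 * (j : ℂ) + 1) * Complex.I * u)

/-- The Jacobi theta function `θ₄(u,q) = Σ_{j∈ℤ} (−1)^j q^{j²} e^{2iju}`. -/
noncomputable def th4 (q u : ℂ) : ℂ :=
  ∑' j : ℤ, (-1 : ℂ) ^ j * q ^ ((j : ℂ) ^ 2) * Complex.exp (2 * (j : ℂ) * Complex.I * u)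

/-- `θ = π/4`. -/
noncomputable def thet : ℂ := (Real.pi : ℂ) / 4

/-- `μ_x²` of the elliptic parametrisation. -/
noncomputable def musq (q t : ℝ) (x : ℤ) : ℂ :=
  (th1 (q : ℂ) thet / th1 (q : ℂ) (2 * thet)) ^ 2 *
    th4 (q : ℂ) ((t : ℂ) + 2 * (x : ℂ) * thet) ^ 2 /
    (th4 (q : ℂ) ((t : ℂ) + (2 * (x : ℂ) - 1) * thet) *
      th4 (q : ℂ) ((t : ℂ) + (2 * (x : ℂ) + 1) * thet))

/-- `λ_x²` of the elliptic parametrisation. -/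
noncomputable def lamsq (q t : ℝ) (x : ℤ) : ℂ :=
  2 * (th1 (q : ℂ) thet / th1 (q : ℂ) (2 * thet)) ^ 2 *
    th4 (q : ℂ) ((t : ℂ) + (2 * (x : ℂ) - 1) * thet) ^ 2 /
    (th4 (q : ℂ) ((t : ℂ) + 2 * ((x : ℂ) - 1) * thet) *
      th4 (q : ℂ) ((t : ℂ) + 2 * (x : ℂ) * thet))

/-- Splitting `ℤ × ℤ` by the parity of the coordinate sum. -/
theorem hasSum_int_prod_of_parity {f : ℤ × ℤ → ℂ} {a b : ℂ}
    (ha : HasSum (fun p : ℤ × ℤ ↦ f (p.1 + p.2, p.1 - p.2)) a)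
    (hb : HasSum (fun p : ℤ × ℤ ↦ f (p.1 + p.2 + 1, p.1 - p.2)) b) : HasSum f (a + b) := by
  have inj₀ : Function.Injective fun p : ℤ × ℤ ↦ (p.1 + p.2, p.1 - p.2) := by
    rintro ⟨r, s⟩ ⟨r', s'⟩ h
    simp only [Prod.mk.injEq] at h ⊢
    omega
  have inj₁ : Function.Injective fun p : ℤ × ℤ ↦ (p.1 + p.2 + 1, p.1 - p.2) := by
    rintro ⟨r, s⟩ ⟨r', s'⟩ h
    simp only [Prod.mk.injEq] at h ⊢
    omega
  refine HasSum.add_isCompl (s := Set.range fun p : ℤ × ℤ ↦ (p.1 + p.2, p.1 - p.2))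
    (t := Set.range fun p : ℤ × ℤ ↦ (p.1 + p.2 + 1, p.1 - p.2)) ?_
    (inj₀.hasSum_range_iff.2 ha) (inj₁.hasSum_range_iff.2 hb)
  rw [← compl_eq_iff_isCompl]
  ext ⟨m, n⟩
  simp only [Set.mem_compl_iff, Set.mem_range, Prod.mk.injEq, Prod.exists, not_exists]
  refine ⟨fun h ↦ ?_, ?_⟩
  · have := h ((m + n) / 2) ((m - n) / 2)
    exact ⟨(m + n - 1) / 2, (m - n - 1) / 2, by omega⟩
  · rintro ⟨r, s, h⟩ r' s'
    omega

theorem HasSum.mul_of_complex {ι κ : Type*} {f : ι → ℂ} {g : κ → ℂ} {a b : ℂ}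
    (hf : HasSum f a) (hg : HasSum g b) :
    HasSum (fun p : ι × κ ↦ f p.1 * g p.2) (a * b) := by
  have h := summable_mul_of_summable_norm hf.summable.norm hg.summable.norm
  exact HasSum.mul hf hg h

theorem hasSum_jacobiTheta₂_mul {x y τ σ : ℂ} (hτ : 0 < τ.im) (hσ : 0 < σ.im) :
    HasSum (fun p : ℤ × ℤ ↦ jacobiTheta₂_term p.1 x τ * jacobiTheta₂_term p.2 y σ)
      (jacobiTheta₂ x τ * jacobiTheta₂ y σ) := by
  have h := (hasSum_jacobiTheta₂_term x hτ).mul_of_complex (hasSum_jacobiTheta₂_term y hσ)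
  exact h

open Complex in
/-- The addition formula expressing a product of theta functions in terms of the doubled period. -/
theorem jacobiTheta₂_mul_jacobiTheta₂ (x y : ℂ) {τ : ℂ} (hτ : 0 < τ.im) :
    jacobiTheta₂ x τ * jacobiTheta₂ y τ =
      jacobiTheta₂ (x + y) (2 * τ) * jacobiTheta₂ (x - y) (2 * τ) +
        cexp (Real.pi * I * (τ + 2 * x)) *
          (jacobiTheta₂ (x + y + τ) (2 * τ) * jacobiTheta₂ (x - y + τ) (2 * τ)) := by
  have hτ' : 0 < (2 * τ).im := by simpa using hτ
  refine (hasSum_jacobiTheta₂_mul hτ hτ).unique (hasSum_int_prod_of_parity ?_ ?_)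
  · refine (hasSum_jacobiTheta₂_mul (x := x + y) (y := x - y) hτ' hτ').congr_fun fun p ↦ ?_
    simp only [jacobiTheta₂_term, ← Complex.exp_add]
    push_cast
    ring_nf
  · refine ((hasSum_jacobiTheta₂_mul (x := x + y + τ)
      (y := x - y + τ) hτ' hτ').mul_left (cexp (Real.pi * I * (τ + 2 * x)))).congr_fun fun p ↦ ?_
    simp only [jacobiTheta₂_term, ← Complex.exp_add]
    push_cast
    ring_nf

open Complex in
theorem jacobiTheta₂_half_add_half_eq_zero (τ : ℂ) : jacobiTheta₂ (τ / 2 + 1 / 2) τ = 0 := by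
  have h₁ : jacobiTheta₂ (τ / 2 + 1 / 2) τ = jacobiTheta₂ (-(τ / 2) + 1 / 2) τ := by
    rw [← jacobiTheta₂_neg_left, ← jacobiTheta₂_add_left]
    ring_nf
  have h₂ := jacobiTheta₂_add_left' (-(τ / 2) + 1 / 2) τ
  rw [show -(τ / 2) + 1 / 2 + τ = τ / 2 + 1 / 2 by ring,
    show -(Real.pi : ℂ) * I * (τ + 2 * (-(τ / 2) + 1 / 2)) = -(Real.pi * I) by ring,
    Complex.exp_neg, Complex.exp_pi_mul_I, ← h₁] at h₂
  norm_num at h₂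
  linear_combination h₂ / 2

open Complex in
/-- On the imaginary axis the theta function is a sum of positive terms. -/
theorem jacobiTheta₂_ofReal_mul_I_ne_zero (y : ℝ) {s : ℝ} (hs : 0 < s) :
    jacobiTheta₂ (y * I) (s * I) ≠ 0 := by
  have h := hasSum_jacobiTheta₂_term (y * I) (τ := s * I) (by simpa using hs)
  have e : ∀ n : ℤ, jacobiTheta₂_term n (y * I) (s * I) =
      (Real.exp (-2 * Real.pi * n * y - Real.pi * n ^ 2 * s) : ℝ) := by
    intro n
    rw [jacobiTheta₂_term]
    push_cast
    congr 1
    linear_combination (2 * Real.pi * n * y + Real.pi * n ^ 2 * s : ℂ) * I_sq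
  simp only [e] at h
  rw [← h.tsum_eq, ← Complex.ofReal_tsum, Complex.ofReal_ne_zero]
  exact ((Complex.summable_ofReal.1 h.summable).tsum_pos (fun _ ↦ (Real.exp_pos _).le) 0
    (Real.exp_pos _)).ne'

open Complex in
theorem jacobiTheta₂_ofReal_ne_zero (x : ℝ) {s : ℝ} (hs : 0 < s) :
    jacobiTheta₂ x (s * I) ≠ 0 := by
  have hs' : (s : ℂ) ≠ 0 := Complex.ofReal_ne_zero.2 hs.ne'
  rw [jacobiTheta₂_functional_equation]
  refine mul_ne_zero (mul_ne_zero (one_div_ne_zero ?_) (Complex.exp_ne_zero _)) ?_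
  · rw [Complex.cpow_ne_zero_iff_of_exponent_ne_zero (by norm_num)]
    simp [hs']
  · convert jacobiTheta₂_ofReal_mul_I_ne_zero (-x / s) (one_div_pos.2 hs) using 2
    · push_cast
      field_simp
      simp
    · push_cast
      field_simp
      simp

open Complex in
/-- The purely imaginary `τ` with `q = exp (π i τ)`, for a positive real nome `q`. -/
noncomputable def nomePeriod (q : ℝ) : ℂ := (-Real.log q / Real.pi : ℝ) * I

theorem neg_log_div_pi_pos {q : ℝ} (hq : 0 < q) (hq1 : q < 1) : 0 < -Real.log q / Real.pi :=
  div_pos (neg_pos.2 (Real.log_neg hq hq1)) Real.pi_pos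

theorem nomePeriod_im_pos {q : ℝ} (hq : 0 < q) (hq1 : q < 1) : 0 < (nomePeriod q).im := by
  simpa [nomePeriod] using neg_log_div_pi_pos hq hq1

open Complex in
theorem ofReal_cpow_eq_exp_nomePeriod {q : ℝ} (hq : 0 < q) (z : ℂ) :
    (q : ℂ) ^ z = cexp (Real.pi * I * nomePeriod q * z) := by
  have hpi : (Real.pi : ℂ) ≠ 0 := Complex.ofReal_ne_zero.2 Real.pi_ne_zero
  rw [Complex.cpow_def_of_ne_zero (Complex.ofReal_ne_zero.2 hq.ne'), ← Complex.ofReal_log hq.le,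
    nomePeriod]
  congr 1
  push_cast
  field_simp
  simp

open Complex in
theorem neg_one_zpow_eq_exp (j : ℤ) : (-1 : ℂ) ^ j = cexp (j * (Real.pi * I)) := by
  rw [Complex.exp_int_mul, Complex.exp_pi_mul_I]

open Complex in
theorem th4_eq_jacobiTheta₂ {q : ℝ} (hq : 0 < q) (u : ℂ) :
    th4 q u = jacobiTheta₂ (u / Real.pi + 1 / 2) (nomePeriod q) := by
  have hpi : (Real.pi : ℂ) ≠ 0 := Complex.ofReal_ne_zero.2 Real.pi_ne_zero
  refine tsum_congr fun j ↦ ?_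
  rw [ofReal_cpow_eq_exp_nomePeriod hq, neg_one_zpow_eq_exp, jacobiTheta₂_term, ← Complex.exp_add,
    ← Complex.exp_add]
  congr 1
  field_simp
  ring

open Complex in
theorem th1_eq_jacobiTheta₂ {q : ℝ} (hq : 0 < q) (u : ℂ) :
    th1 q u = -I * (cexp (Real.pi * I * nomePeriod q / 4 + I * u) *
      jacobiTheta₂ (u / Real.pi + 1 / 2 + nomePeriod q / 2) (nomePeriod q)) := by
  have hpi : (Real.pi : ℂ) ≠ 0 := Complex.ofReal_ne_zero.2 Real.pi_ne_zero
  rw [th1, jacobiTheta₂, ← tsum_mul_left (a := cexp _)]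
  refine congrArg (-I * ·) (tsum_congr fun j ↦ ?_)
  rw [ofReal_cpow_eq_exp_nomePeriod hq, neg_one_zpow_eq_exp, jacobiTheta₂_term, ← Complex.exp_add,
    ← Complex.exp_add, ← Complex.exp_add]
  congr 1
  field_simp
  ring

open Complex in
theorem th4_ofReal_ne_zero {q : ℝ} (hq : 0 < q) (hq1 : q < 1) (u : ℝ) : th4 q u ≠ 0 := by
  rw [th4_eq_jacobiTheta₂ hq, nomePeriod]
  convert jacobiTheta₂_ofReal_ne_zero (u / Real.pi + 1 / 2) (neg_log_div_pi_pos hq hq1)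
  push_cast
  rfl

theorem th4_add_pi {q : ℝ} (hq : 0 < q) (u : ℂ) : th4 q (u + Real.pi) = th4 q u := by
  have hpi : (Real.pi : ℂ) ≠ 0 := Complex.ofReal_ne_zero.2 Real.pi_ne_zero
  rw [th4_eq_jacobiTheta₂ hq, th4_eq_jacobiTheta₂ hq, add_div, div_self hpi, add_right_comm,
    jacobiTheta₂_add_left]

theorem th4_sq_add_th4_sq {q : ℝ} (hq : 0 < q) (hq1 : q < 1) (a : ℂ) :
    th4 q a ^ 2 + th4 q (a + 2 * thet) ^ 2 =
      2 * jacobiTheta₂ (2 * (a / Real.pi)) (2 * nomePeriod q) *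
        jacobiTheta₂ 0 (2 * nomePeriod q) := by
  have hpi : (Real.pi : ℂ) ≠ 0 := Complex.ofReal_ne_zero.2 Real.pi_ne_zero
  have hτ := nomePeriod_im_pos hq hq1
  rw [th4_eq_jacobiTheta₂ hq, th4_eq_jacobiTheta₂ hq, thet,
    show (a + 2 * (Real.pi / 4)) / Real.pi + 1 / 2 = a / Real.pi + 1 by field_simp; ring,
    jacobiTheta₂_add_left, sq, sq, jacobiTheta₂_mul_jacobiTheta₂ _ _ hτ,
    jacobiTheta₂_mul_jacobiTheta₂ _ _ hτ]
  generalize a / (Real.pi : ℂ) = z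
  generalize nomePeriod q = τ
  rw [show Real.pi * Complex.I * (τ + 2 * (z + 1 / 2)) =
      Real.pi * Complex.I * (τ + 2 * z) + Real.pi * Complex.I by ring, Complex.exp_add,
    Complex.exp_pi_mul_I, show z + 1 / 2 + (z + 1 / 2) + τ = z + z + τ + 1 by ring,
    show z + 1 / 2 + (z + 1 / 2) = 2 * z + 1 by ring, jacobiTheta₂_add_left,
    jacobiTheta₂_add_left, ← two_mul z, sub_self, sub_self]
  ring

theorem th4_sub_mul_th4_add {q : ℝ} (hq : 0 < q) (hq1 : q < 1) (a : ℂ) :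
    th4 q (a - thet) * th4 q (a + thet) =
      jacobiTheta₂ (2 * (a / Real.pi)) (2 * nomePeriod q) *
        jacobiTheta₂ (1 / 2) (2 * nomePeriod q) := by
  have hpi : (Real.pi : ℂ) ≠ 0 := Complex.ofReal_ne_zero.2 Real.pi_ne_zero
  have hτ := nomePeriod_im_pos hq hq1
  rw [mul_comm, th4_eq_jacobiTheta₂ hq, th4_eq_jacobiTheta₂ hq, thet,
    jacobiTheta₂_mul_jacobiTheta₂ _ _ hτ, add_div, sub_div,
    show (Real.pi : ℂ) / 4 / Real.pi = 1 / 4 by field_simp]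
  generalize a / (Real.pi : ℂ) = z
  generalize nomePeriod q = τ
  rw [show z + 1 / 4 + 1 / 2 + (z - 1 / 4 + 1 / 2) = 2 * z + 1 by ring,
    show z + 1 / 4 + 1 / 2 - (z - 1 / 4 + 1 / 2) = 1 / 2 by ring, jacobiTheta₂_add_left,
    show 1 / 2 + τ = 2 * τ / 2 + 1 / 2 by ring, jacobiTheta₂_half_add_half_eq_zero]
  ring

open Complex in
theorem jacobiTheta₂_add_period_two_mul (z τ : ℂ) : jacobiTheta₂ (z + 2 * τ) (2 * τ) =
    cexp (-(2 * (Real.pi * I * (τ + z)))) * jacobiTheta₂ z (2 * τ) := by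
  rw [jacobiTheta₂_add_left']
  ring_nf

open Complex in
theorem th1_two_mul_thet_sq {q : ℝ} (hq : 0 < q) (hq1 : q < 1) :
    th1 q (2 * thet) ^ 2 = 2 * cexp (Real.pi * I * nomePeriod q / 2) *
      jacobiTheta₂ (nomePeriod q) (2 * nomePeriod q) * jacobiTheta₂ 0 (2 * nomePeriod q) := by
  have hpi : (Real.pi : ℂ) ≠ 0 := Complex.ofReal_ne_zero.2 Real.pi_ne_zero
  have hτ := nomePeriod_im_pos hq hq1
  rw [th1_eq_jacobiTheta₂ hq, thet,
    show 2 * ((Real.pi : ℂ) / 4) / Real.pi + 1 / 2 + nomePeriod q / 2 = nomePeriod q / 2 + 1 by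
      field_simp; ring, jacobiTheta₂_add_left, mul_pow, mul_pow, sq (jacobiTheta₂ _ _),
    jacobiTheta₂_mul_jacobiTheta₂ _ _ hτ]
  generalize nomePeriod q = τ
  have h := jacobiTheta₂_add_period_two_mul 0 τ
  rw [zero_add, add_zero] at h
  rw [sub_self, zero_add, add_halves, ← two_mul τ, h, ← Complex.exp_nat_mul,
    show ((2 : ℕ) : ℂ) * (Real.pi * I * τ / 4 + I * (2 * (Real.pi / 4))) =
      Real.pi * I * τ / 2 + Real.pi * I by push_cast; ring, Complex.exp_add, Complex.exp_pi_mul_I,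
    show Real.pi * I * (τ + 2 * (τ / 2)) = 2 * (Real.pi * I * τ) by ring, Complex.exp_neg,
    neg_sq, I_sq]
  field_simp
  ring

open Complex in
theorem th1_thet_sq {q : ℝ} (hq : 0 < q) (hq1 : q < 1) :
    th1 q thet ^ 2 = cexp (Real.pi * I * nomePeriod q / 2) *
      jacobiTheta₂ (nomePeriod q) (2 * nomePeriod q) *
        jacobiTheta₂ (1 / 2) (2 * nomePeriod q) := by
  have hpi : (Real.pi : ℂ) ≠ 0 := Complex.ofReal_ne_zero.2 Real.pi_ne_zero
  have hτ := nomePeriod_im_pos hq hq1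
  rw [th1_eq_jacobiTheta₂ hq, thet,
    show (Real.pi : ℂ) / 4 / Real.pi + 1 / 2 + nomePeriod q / 2 = nomePeriod q / 2 + 3 / 4 by
      field_simp; ring, mul_pow, mul_pow, sq (jacobiTheta₂ _ _),
    jacobiTheta₂_mul_jacobiTheta₂ _ _ hτ]
  generalize nomePeriod q = τ
  rw [sub_self, zero_add, show τ / 2 + 3 / 4 + (τ / 2 + 3 / 4) + τ = 1 / 2 + 2 * τ + 1 by ring,
    show τ / 2 + 3 / 4 + (τ / 2 + 3 / 4) = 2 * τ / 2 + 1 / 2 + 1 by ring,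
    jacobiTheta₂_add_left, jacobiTheta₂_add_left, jacobiTheta₂_half_add_half_eq_zero,
    jacobiTheta₂_add_period_two_mul, neg_sq, I_sq, zero_mul, zero_add, ← Complex.exp_nat_mul]
  have key : cexp ((2 : ℕ) * (Real.pi * I * τ / 4 + I * (Real.pi / 4))) *
      cexp (Real.pi * I * (τ + 2 * (τ / 2 + 3 / 4))) *
        cexp (-(2 * (Real.pi * I * (τ + 1 / 2)))) = -cexp (Real.pi * I * τ / 2) := by
    rw [← Complex.exp_add, ← Complex.exp_add, ← Complex.exp_add_pi_mul_I]
    push_cast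
    ring_nf
  linear_combination (-jacobiTheta₂ τ (2 * τ) * jacobiTheta₂ (1 / 2) (2 * τ)) * key

theorem th1_two_mul_thet_ne_zero {q : ℝ} (hq : 0 < q) (hq1 : q < 1) :
    th1 q (2 * thet) ≠ 0 := by
  have hs : 0 < 2 * (-Real.log q / Real.pi) := mul_pos two_pos (neg_log_div_pi_pos hq hq1)
  have e : 2 * nomePeriod q = (2 * (-Real.log q / Real.pi) : ℝ) * Complex.I := by
    rw [nomePeriod]
    push_cast
    ring
  rw [← pow_ne_zero_iff two_ne_zero, th1_two_mul_thet_sq hq hq1, e]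
  refine mul_ne_zero (mul_ne_zero (by simp) ?_) ?_
  · exact jacobiTheta₂_ofReal_mul_I_ne_zero _ hs
  · exact_mod_cast jacobiTheta₂_ofReal_ne_zero 0 hs

theorem theta_addition_quarter_period {q : ℝ} (hq : 0 < q) (hq1 : q < 1) {a : ℂ}
    (h₁ : th4 q (a - thet) ≠ 0) (h₂ : th4 q (a + thet) ≠ 0) :
    (th1 q thet / th1 q (2 * thet)) ^ 2 *
      (th4 q a ^ 2 / (th4 q (a - thet) * th4 q (a + thet)) +
        th4 q (a + 2 * thet) ^ 2 / (th4 q (a + thet) * th4 q (a + 3 * thet))) = 1 := by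
  have e : th4 q (a + 3 * thet) = th4 q (a - thet) := by
    rw [← th4_add_pi hq (a - thet), thet]
    ring_nf
  rw [e, mul_comm (th4 q (a + thet)), ← add_div, div_pow, div_mul_div_comm,
    div_eq_one_iff_eq (mul_ne_zero (pow_ne_zero 2 (th1_two_mul_thet_ne_zero hq hq1))
      (mul_ne_zero h₁ h₂)), th4_sq_add_th4_sq hq hq1, th4_sub_mul_th4_add hq hq1,
    th1_thet_sq hq hq1, th1_two_mul_thet_sq hq hq1]
  ring

/-- for `0 < q < 1`, `θ = π/4` and real `t`, the elliptic parametrisation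
satisfies `μ_x² + μ_{x+1}² = 1` and `λ_x² + λ_{x+1}² = 2` for every integer `x`;
equivalently, for every `a ∈ ℂ` where the denominators are nonzero,
`(θ₁(θ)/θ₁(2θ))² [θ₄(a)²/(θ₄(a−θ)θ₄(a+θ)) + θ₄(a+2θ)²/(θ₄(a+θ)θ₄(a+3θ))] = 1`. -/
theorem stmt4 (q t : ℝ) (hq : 0 < q) (hq1 : q < 1) :
    (∀ x : ℤ, musq q t x + musq q t (x + 1) = 1 ∧ lamsq q t x + lamsq q t (x + 1) = 2) ∧
    (∀ a : ℂ, th4 (q : ℂ) (a - thet) ≠ 0 → th4 (q : ℂ) (a + thet) ≠ 0 →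
      th4 (q : ℂ) (a + 3 * thet) ≠ 0 →
      (th1 (q : ℂ) thet / th1 (q : ℂ) (2 * thet)) ^ 2 *
        (th4 (q : ℂ) a ^ 2 / (th4 (q : ℂ) (a - thet) * th4 (q : ℂ) (a + thet)) +
          th4 (q : ℂ) (a + 2 * thet) ^ 2 /
            (th4 (q : ℂ) (a + thet) * th4 (q : ℂ) (a + 3 * thet))) = 1) := by
  have real_ne (m : ℂ) (r : ℝ) (hm : m = r) : th4 q m ≠ 0 := hm ▸ th4_ofReal_ne_zero hq hq1 r
  refine ⟨fun x ↦ ⟨?_, ?_⟩, fun a h₁ h₂ _ ↦ theta_addition_quarter_period hq hq1 h₁ h₂⟩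
  · rw [← theta_addition_quarter_period hq hq1 (a := t + 2 * x * thet)
      (real_ne _ (t + 2 * x * (Real.pi / 4) - Real.pi / 4) (by simp [thet]))
      (real_ne _ (t + 2 * x * (Real.pi / 4) + Real.pi / 4) (by simp [thet])), musq, musq]
    push_cast
    ring_nf
  · rw [← mul_one (2 : ℂ), ← theta_addition_quarter_period hq hq1 (a := t + (2 * x - 1) * thet)
      (real_ne _ (t + (2 * x - 1) * (Real.pi / 4) - Real.pi / 4) (by simp [thet]))
      (real_ne _ (t + (2 * x - 1) * (Real.pi / 4) + Real.pi / 4) (by simp [thet])), lamsq, lamsq]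
    push_cast
    ring_nf
end

section
/- Let λ₁, λ₂, μ₁, μ₂, ε ∈ ℂ and z ∈ ℂ with z ≠ 0, and suppose λ₁² + λ₂² = 2 and μ₁² + μ₂² = 1. Then (ε + λ₁²)(ε + λ₂²) − λ₁²λ₂²(μ₂² z + μ₁² z⁻¹)(μ₁² z + μ₂² z⁻¹) = ε(ε + 2) − λ₁²λ₂²μ₁²μ₂² (z − z⁻¹)². Consequently, there exists a nonzero pair (A₁, A₂) ∈ ℂ² satisfying the two-site recursion (ε + λ₂²)A₁ = λ₁λ₂(μ₂² z + μ₁² z⁻¹)A₂ and (ε + λ₁²)A₂ = λ₁λ₂(μ₁² z + μ₂² z⁻¹)A₁ if and only if ε(ε + 2) = λ₁²λ₂²μ₁²μ₂² (z − z⁻¹)². -/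
/-- The homogeneous system `a x = b y`, `d y = c x` over a field has a nonzero solution
iff its determinant `a d - b c` vanishes. -/
theorem exists_nonzero_solution_iff {K : Type*} [Field K] (a b c d : K) :
    (∃ x y : K, ¬(x = 0 ∧ y = 0) ∧ a * x = b * y ∧ d * y = c * x) ↔ a * d - b * c = 0 := by
  constructor
  · rintro ⟨x, y, hne, h1, h2⟩
    by_cases hx : x = 0
    · have hy : y ≠ 0 := fun hy => hne ⟨hx, hy⟩
      refine (mul_eq_zero.mp ?_).resolve_right hy
      linear_combination a * h2 + c * h1
    · refine (mul_eq_zero.mp ?_).resolve_right hx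
      linear_combination d * h1 + b * h2
  · intro h
    by_cases hba : b = 0 ∧ a = 0
    · obtain ⟨rfl, rfl⟩ := hba
      by_cases hdc : d = 0 ∧ c = 0
      · obtain ⟨rfl, rfl⟩ := hdc
        exact ⟨1, 0, by simp, by simp, by simp⟩
      · exact ⟨d, c, hdc, by simp, mul_comm d c⟩
    · exact ⟨b, a, hba, mul_comm a b, by linear_combination h⟩

/-- the one-particle dispersion relation of the 2-periodically staggered
M₂ model: the determinant identity for the two-site Bloch recursion, and existence of a
nontrivial solution `(A₁, A₂)` iff `ε(ε+2) = λ₁²λ₂²μ₁²μ₂²(z − z⁻¹)²`. -/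
theorem stmt6 (l1 l2 m1 m2 e z : ℂ) (hz : z ≠ 0)
    (hl : l1 ^ 2 + l2 ^ 2 = 2) (hm : m1 ^ 2 + m2 ^ 2 = 1) :
    ((e + l1 ^ 2) * (e + l2 ^ 2) -
        l1 ^ 2 * l2 ^ 2 * (m2 ^ 2 * z + m1 ^ 2 * z⁻¹) * (m1 ^ 2 * z + m2 ^ 2 * z⁻¹) =
      e * (e + 2) - l1 ^ 2 * l2 ^ 2 * m1 ^ 2 * m2 ^ 2 * (z - z⁻¹) ^ 2) ∧
    ((∃ A1 A2 : ℂ, ¬(A1 = 0 ∧ A2 = 0) ∧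
        (e + l2 ^ 2) * A1 = l1 * l2 * (m2 ^ 2 * z + m1 ^ 2 * z⁻¹) * A2 ∧
        (e + l1 ^ 2) * A2 = l1 * l2 * (m1 ^ 2 * z + m2 ^ 2 * z⁻¹) * A1) ↔
      e * (e + 2) = l1 ^ 2 * l2 ^ 2 * m1 ^ 2 * m2 ^ 2 * (z - z⁻¹) ^ 2) := by
  have hw : z * z⁻¹ = 1 := mul_inv_cancel₀ hz
  have key : (e + l1 ^ 2) * (e + l2 ^ 2) -
        l1 ^ 2 * l2 ^ 2 * (m2 ^ 2 * z + m1 ^ 2 * z⁻¹) * (m1 ^ 2 * z + m2 ^ 2 * z⁻¹) =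
      e * (e + 2) - l1 ^ 2 * l2 ^ 2 * m1 ^ 2 * m2 ^ 2 * (z - z⁻¹) ^ 2 := by
    generalize z⁻¹ = w at hw ⊢
    linear_combination e * hl - l1 ^ 2 * l2 ^ 2 * (m1 ^ 2 + m2 ^ 2 + 1) * hm -
      l1 ^ 2 * l2 ^ 2 * (m1 ^ 2 + m2 ^ 2) ^ 2 * hw
  refine ⟨key, ?_⟩
  rw [exists_nonzero_solution_iff, ← sub_eq_zero (a := e * (e + 2)), ← key]
  ring_nf
end

section
/- Fix 0 < q < 1 and θ = π/4, and define z(u) = −θ1(u+θ)/θ1(u−θ), ε(u) = −2 (θ1(θ)/θ1(2θ))² · θ1(u)²/(θ1(u−θ)θ1(u+θ)), and Λ = 2 (θ1(θ)/θ1(2θ))⁴. Then for every u ∈ ℂ with θ1(u−θ) ≠ 0 and θ1(u+θ) ≠ 0, one has ε(u)(ε(u) + 2) = Λ² (z(u) − z(u)⁻¹)². -/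
/-- The elliptic rapidity `z(u) = −θ₁(u+θ)/θ₁(u−θ)`. -/
noncomputable def zrap (q u : ℂ) : ℂ := -th1 q (u + thet) / th1 q (u - thet)

/-- The single-particle excitation energy
`ε(u) = −2 (θ₁(θ)/θ₁(2θ))² θ₁(u)²/(θ₁(u−θ)θ₁(u+θ))`. -/
noncomputable def eps (q u : ℂ) : ℂ :=
  -2 * (th1 q thet / th1 q (2 * thet)) ^ 2 * th1 q u ^ 2 /
    (th1 q (u - thet) * th1 q (u + thet))

/-- Summability of a Gaussian family over the integers. -/
theorem summable_cexp_quadratic (a b c : ℂ) (ha : a.re < 0) :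
    Summable fun j : ℤ => Complex.exp (a * (j : ℂ) ^ 2 + b * j + c) := by
  have hpi : (Real.pi : ℂ) ≠ 0 := by exact_mod_cast Real.pi_ne_zero
  have him : 0 < (a / (Real.pi * Complex.I)).im := by
    have h : a / (Real.pi * Complex.I) = ((Real.pi⁻¹ : ℝ) : ℂ) * (-(a * Complex.I)) := by
      push_cast
      field_simp
      rw [Complex.I_sq]
      ring
    rw [h, Complex.im_ofReal_mul, Complex.neg_im, Complex.mul_I_im]
    exact mul_pos (inv_pos.2 Real.pi_pos) (neg_pos.2 ha)
  have h := ((summable_jacobiTheta₂_term_iff (b / (2 * Real.pi * Complex.I))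
    (a / (Real.pi * Complex.I))).2 him).mul_left (Complex.exp c)
  refine h.congr fun j => ?_
  rw [jacobiTheta₂_term, ← Complex.exp_add]
  congr 1
  field_simp
  ring

/-- The even part `Σ_k e^{2Lk² + 2ikw}` of the theta series of nome `e^{L/2}`. -/
noncomputable def thetaEven (L w : ℂ) : ℂ :=
  ∑' k : ℤ, Complex.exp (2 * L * (k : ℂ) ^ 2 + 2 * Complex.I * w * k)

/-- The odd part `Σ_k e^{L(2k+1)²/2 + i(2k+1)w}` of the theta series of nome `e^{L/2}`. -/
noncomputable def thetaOdd (L w : ℂ) : ℂ :=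
  ∑' k : ℤ, Complex.exp (L * (2 * (k : ℂ) + 1) ^ 2 / 2 + Complex.I * (2 * k + 1) * w)

theorem thetaEven_add_pi (L w : ℂ) : thetaEven L (w + Real.pi) = thetaEven L w := by
  refine tsum_congr fun k => ?_
  refine Complex.exp_eq_exp_iff_exists_int.2 ⟨k, ?_⟩
  ring

theorem thetaOdd_add_pi (L w : ℂ) : thetaOdd L (w + Real.pi) = -thetaOdd L w := by
  rw [thetaOdd, thetaOdd, ← tsum_neg]
  refine tsum_congr fun k => ?_
  rw [← neg_one_mul, ← Complex.exp_pi_mul_I, ← Complex.exp_add]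
  refine Complex.exp_eq_exp_iff_exists_int.2 ⟨k, ?_⟩
  ring

theorem thetaOdd_neg (L w : ℂ) : thetaOdd L (-w) = thetaOdd L w := by
  rw [thetaOdd, thetaOdd, ← (Equiv.subLeft (-1 : ℤ)).tsum_eq]
  refine tsum_congr fun k => ?_
  congr 1
  simp only [Equiv.subLeft_apply]
  push_cast
  ring

theorem thetaOdd_pi_div_two (L : ℂ) : thetaOdd L (Real.pi / 2) = 0 := by
  have h := thetaOdd_add_pi L (-(Real.pi / 2))
  rw [thetaOdd_neg, show -((Real.pi : ℂ) / 2) + Real.pi = Real.pi / 2 by ring] at h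
  linear_combination h / 2

/-- The bijection of `ℤ × ℤ` with two copies of itself given by the parity of `j + k`. -/
theorem bijective_parity_split :
    Function.Bijective (Sum.elim (fun p : ℤ × ℤ => (p.1 + p.2, p.1 - p.2 - 1))
      (fun p : ℤ × ℤ => (p.1 + p.2, p.1 - p.2))) := by
  constructor
  · rintro (⟨a, b⟩ | ⟨a, b⟩) (⟨c, d⟩ | ⟨c, d⟩) h <;>
      simp only [Sum.elim_inl, Sum.elim_inr, Prod.mk.injEq, Sum.inl.injEq, Sum.inr.injEq,
        reduceCtorEq] at h ⊢ <;> omega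
  · rintro ⟨j, k⟩
    rcases Int.even_or_odd' (j + k) with ⟨m, hm | hm⟩
    · refine ⟨Sum.inr (m, j - m), ?_⟩
      simp only [Sum.elim_inr, Prod.mk.injEq]
      omega
    · refine ⟨Sum.inl (m + 1, j - m - 1), ?_⟩
      simp only [Sum.elim_inl, Prod.mk.injEq]
      omega

theorem tsum_int_prod_parity_split {f : ℤ × ℤ → ℂ} (hf : Summable f) :
    ∑' p, f p = ∑' p : ℤ × ℤ, f (p.1 + p.2, p.1 - p.2 - 1) +
      ∑' p : ℤ × ℤ, f (p.1 + p.2, p.1 - p.2) := by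
  set e := Equiv.ofBijective _ bijective_parity_split
  have hs : Summable (f ∘ e) := e.summable_iff.2 hf
  rw [← e.tsum_eq f]
  exact Summable.tsum_sum (hs.comp_injective Sum.inl_injective)
    (hs.comp_injective Sum.inr_injective)

theorem th1_eq_tsum_cexp {q : ℂ} (hq : q ≠ 0) (u : ℂ) :
    th1 q u = -Complex.I * ∑' j : ℤ, Complex.exp (Complex.log q * (j : ℂ) ^ 2 +
      (Real.pi * Complex.I + Complex.log q + 2 * Complex.I * u) * j +
      (Complex.log q / 4 + Complex.I * u)) := by
  rw [th1]
  congr 1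
  refine tsum_congr fun j => ?_
  rw [Complex.cpow_def_of_ne_zero hq, ← Complex.exp_pi_mul_I, ← Complex.exp_int_mul,
    ← Complex.exp_add, ← Complex.exp_add]
  congr 1
  ring

theorem th1_mul_th1 {q : ℂ} (hq : q ≠ 0) (hlog : (Complex.log q).re < 0) (x y : ℂ) :
    th1 q x * th1 q y =
      thetaEven (Complex.log q) (x + y) * thetaOdd (Complex.log q) (x - y) -
        thetaOdd (Complex.log q) (x + y) * thetaEven (Complex.log q) (x - y) := by
  set L := Complex.log q with hL
  have hL2 : (2 * L).re < 0 := by simpa using mul_neg_of_pos_of_neg two_pos hlog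
  have hE (w : ℂ) : Summable fun k : ℤ =>
      ‖Complex.exp (2 * L * (k : ℂ) ^ 2 + 2 * Complex.I * w * k)‖ := by
    simpa using (summable_cexp_quadratic (2 * L) (2 * Complex.I * w) 0 hL2).norm
  have hO (w : ℂ) : Summable fun k : ℤ =>
      ‖Complex.exp (L * (2 * (k : ℂ) + 1) ^ 2 / 2 + Complex.I * (2 * k + 1) * w)‖ := by
    refine (summable_cexp_quadratic (2 * L) (2 * L + 2 * Complex.I * w)
      (L / 2 + Complex.I * w) hL2).norm.congr fun k => ?_
    congr 2
    ring
  have hT (w : ℂ) := (summable_cexp_quadratic L (Real.pi * Complex.I + L + 2 * Complex.I * w)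
    (L / 4 + Complex.I * w) hlog).norm
  rw [th1_eq_tsum_cexp hq, th1_eq_tsum_cexp hq, mul_mul_mul_comm, ← hL,
    tsum_mul_tsum_of_summable_norm (hT x) (hT y),
    tsum_int_prod_parity_split (summable_mul_of_summable_norm (hT x) (hT y)),
    thetaEven, thetaOdd, thetaOdd, thetaEven,
    tsum_mul_tsum_of_summable_norm (hE _) (hO _), tsum_mul_tsum_of_summable_norm (hO _) (hE _),
    neg_mul_neg, Complex.I_mul_I, neg_one_mul, neg_add, ← tsum_neg, sub_eq_add_neg]
  congr 1
  · refine tsum_congr fun p => ?_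
    rw [← Complex.exp_add, ← Complex.exp_add, ← neg_one_mul, ← Complex.exp_pi_mul_I,
      ← Complex.exp_add]
    refine Complex.exp_eq_exp_iff_exists_int.2 ⟨p.1, ?_⟩
    push_cast
    ring
  · congr 1
    refine tsum_congr fun p => ?_
    rw [← Complex.exp_add, ← Complex.exp_add]
    refine Complex.exp_eq_exp_iff_exists_int.2 ⟨p.1, ?_⟩
    push_cast
    ring

theorem th1_add_pi {q : ℂ} (hq : q ≠ 0) (u : ℂ) : th1 q (u + Real.pi) = -th1 q u := by
  rw [th1_eq_tsum_cexp hq, th1_eq_tsum_cexp hq, ← mul_neg, ← tsum_neg]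
  congr 1
  refine tsum_congr fun j => ?_
  rw [← neg_one_mul, ← Complex.exp_pi_mul_I, ← Complex.exp_add]
  refine Complex.exp_eq_exp_iff_exists_int.2 ⟨j, ?_⟩
  ring

/-- The quarter-period relation between the squares of `θ₁` at `u ± π/4`. -/
theorem th1_sq_sub_sq {q : ℂ} (hq : q ≠ 0) (hlog : (Complex.log q).re < 0) (u : ℂ) :
    th1 q thet ^ 2 * (th1 q (u + thet) ^ 2 - th1 q (u - thet) ^ 2) =
      th1 q (2 * thet) ^ 2 * (th1 q (u + 2 * thet) * th1 q u) := by
  have h (x y : ℂ) := th1_mul_th1 hq hlog x y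
  have e0 := thetaOdd_pi_div_two (Complex.log q)
  have e1 := thetaEven_add_pi (Complex.log q) (2 * u - Real.pi / 2)
  have e2 := thetaOdd_add_pi (Complex.log q) (2 * u - Real.pi / 2)
  have e3 := thetaEven_add_pi (Complex.log q) 0
  have e4 := thetaOdd_add_pi (Complex.log q) 0
  rw [show 2 * u - (Real.pi : ℂ) / 2 + Real.pi = 2 * u + Real.pi / 2 by ring] at e1 e2
  rw [zero_add] at e3 e4
  simp only [sq, h, thet, sub_self]
  rw [show (Real.pi : ℂ) / 4 + Real.pi / 4 = Real.pi / 2 by ring,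
    show u + (Real.pi : ℂ) / 4 + (u + Real.pi / 4) = 2 * u + Real.pi / 2 by ring,
    show u - (Real.pi : ℂ) / 4 + (u - Real.pi / 4) = 2 * u - Real.pi / 2 by ring,
    show 2 * ((Real.pi : ℂ) / 4) + 2 * (Real.pi / 4) = Real.pi by ring,
    show u + 2 * ((Real.pi : ℂ) / 4) + u = 2 * u + Real.pi / 2 by ring,
    show u + 2 * ((Real.pi : ℂ) / 4) - u = Real.pi / 2 by ring, e0, e1, e2, e3, e4]
  ring

/-- with `Λ = 2(θ₁(θ)/θ₁(2θ))⁴`, the dispersion relation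
`ε(u)(ε(u)+2) = Λ²(z(u) − z(u)⁻¹)²` holds wherever `θ₁(u±θ) ≠ 0`. -/
theorem stmt7 (q : ℝ) (hq : 0 < q) (hq1 : q < 1) (u : ℂ)
    (h1 : th1 (q : ℂ) (u - thet) ≠ 0) (h2 : th1 (q : ℂ) (u + thet) ≠ 0) :
    eps (q : ℂ) u * (eps (q : ℂ) u + 2) =
      (2 * (th1 (q : ℂ) thet / th1 (q : ℂ) (2 * thet)) ^ 4) ^ 2 *
        (zrap (q : ℂ) u - (zrap (q : ℂ) u)⁻¹) ^ 2 := by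
  have hq0 : (q : ℂ) ≠ 0 := by exact_mod_cast hq.ne'
  have hlog : (Complex.log (q : ℂ)).re < 0 := by
    rw [Complex.log_ofReal_re]
    exact Real.log_neg hq hq1
  have k1 := th1_sq_sub_sq hq0 hlog u
  have k2 := th1_sq_sub_sq hq0 hlog (u + thet)
  have hp := th1_add_pi hq0 (u - thet)
  rw [show u - thet + Real.pi = u + thet + 2 * thet by rw [thet]; ring] at hp
  rw [hp, add_sub_cancel_right, show u + thet + thet = u + 2 * thet by ring] at k2
  rw [eps, zrap]
  by_cases h0 : th1 (q : ℂ) (2 * thet) = 0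
  · simp [h0]
  set a := th1 (q : ℂ) (u - thet)
  set b := th1 (q : ℂ) (u + thet)
  set c := th1 (q : ℂ) (u + 2 * thet)
  set s := th1 (q : ℂ) u
  set r := th1 (q : ℂ) thet / th1 (q : ℂ) (2 * thet) with hr
  have m1 : r ^ 2 * (b ^ 2 - a ^ 2) = c * s := by
    rw [hr]
    field_simp
    linear_combination k1
  have m2 : r ^ 2 * (s ^ 2 - c ^ 2) = a * b := by
    rw [hr]
    field_simp
    linear_combination -k2
  have hz : -b / a - (-b / a)⁻¹ = -(b ^ 2 - a ^ 2) / (a * b) := by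
    field_simp
    ring
  rw [hz]
  clear_value r
  field_simp
  linear_combination r ^ 2 * s ^ 2 * m2 - r ^ 4 * (r ^ 2 * (b ^ 2 - a ^ 2) + c * s) * m1
end

section
/- Let f ≥ 2 and let r : {1,…,f} × {1,…,f} → ℂ be an arbitrary function. Define, for each permutation σ of {1,…,f}, B_σ = sign(σ) · Π_{1 ≤ m < n ≤ f} r(σ(n), σ(m)). Then for every permutation σ and every i ∈ {1,…,f−1}, B_σ · r(σ(i), σ(i+1)) + B_{σ∘τ_i} · r(σ(i+1), σ(i)) = 0, where τ_i is the transposition of i and i+1. In particular, the amplitudes B_σ solve the Bethe-ansatz amplitude equations B_{…σ(i),σ(i+1)…} r(u_{σ(i)}, u_{σ(i+1)}) + B_{…σ(i+1),σ(i)…} r(u_{σ(i+1)}, u_{σ(i)}) = 0 for any choice of the two-particle kernel r. -/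
/-- An adjacent transposition permutes the increasing pairs other than the transposed one. -/
theorem swap_lt_swap_of_lt {f : ℕ} {i j : Fin f} (hij : (j : ℕ) = (i : ℕ) + 1)
    {a b : Fin f} (hab : a < b) (hne : (a, b) ≠ (i, j)) :
    Equiv.swap i j a < Equiv.swap i j b ∧ (Equiv.swap i j a, Equiv.swap i j b) ≠ (i, j) := by
  simp only [ne_eq, Prod.mk.injEq, Fin.lt_def, Fin.ext_iff] at hab hne ⊢
  simp only [Equiv.swap_apply_def]
  split_ifs <;> simp only [Fin.ext_iff] at * <;> omega

/-- Away from the transposed pair, a product over increasing pairs is invariant under an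
adjacent transposition. -/
theorem prod_erase_swap {M : Type*} [CommMonoid M] {f : ℕ} {i j : Fin f}
    (hij : (j : ℕ) = (i : ℕ) + 1) (g : Fin f → Fin f → M) :
    ∏ p ∈ (Finset.univ.filter (fun p : Fin f × Fin f => p.1 < p.2)).erase (i, j),
        g (Equiv.swap i j p.1) (Equiv.swap i j p.2) =
      ∏ p ∈ (Finset.univ.filter (fun p : Fin f × Fin f => p.1 < p.2)).erase (i, j),
        g p.1 p.2 := by
  have hmaps : ∀ p ∈ (Finset.univ.filter (fun p : Fin f × Fin f => p.1 < p.2)).erase (i, j),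
      (Equiv.swap i j p.1, Equiv.swap i j p.2) ∈
        (Finset.univ.filter (fun p : Fin f × Fin f => p.1 < p.2)).erase (i, j) := by
    rintro ⟨a, b⟩ hp
    simp only [Finset.mem_erase, Finset.mem_filter, Finset.mem_univ, true_and] at hp ⊢
    exact (swap_lt_swap_of_lt hij hp.2 hp.1).symm
  exact Finset.prod_nbij' (fun p => (Equiv.swap i j p.1, Equiv.swap i j p.2))
    (fun p => (Equiv.swap i j p.1, Equiv.swap i j p.2)) hmaps hmaps
    (by simp) (by simp) (by simp)


/-- the explicit product formula
`B_σ = sign σ · Π_{m<n} r(σ(n), σ(m))` solves the Bethe-ansatz amplitude equations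
`B_σ r(σ(i), σ(i+1)) + B_{σ∘τᵢ} r(σ(i+1), σ(i)) = 0` for every adjacent transposition. -/
theorem stmt13 (f : ℕ) (hf : 2 ≤ f) (r : Fin f → Fin f → ℂ)
    (B : Equiv.Perm (Fin f) → ℂ)
    (hB : ∀ σ : Equiv.Perm (Fin f),
      B σ = ((Equiv.Perm.sign σ : ℤ) : ℂ) *
        ∏ p ∈ Finset.univ.filter (fun p : Fin f × Fin f => p.1 < p.2),
          r (σ p.2) (σ p.1)) :
    ∀ (σ : Equiv.Perm (Fin f)) (i j : Fin f), (j : ℕ) = (i : ℕ) + 1 →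
      B σ * r (σ i) (σ j) + B (σ * Equiv.swap i j) * r (σ j) (σ i) = 0 := by
  intro σ i j hij
  have hlt : i < j := Fin.lt_def.mpr (by omega)
  have hmem : (i, j) ∈ Finset.univ.filter (fun p : Fin f × Fin f => p.1 < p.2) := by
    simpa using hlt
  rw [hB, hB, ← Finset.mul_prod_erase _ _ hmem, ← Finset.mul_prod_erase _ _ hmem]
  simp only [Equiv.Perm.mul_apply, Equiv.swap_apply_left, Equiv.swap_apply_right,
    Equiv.Perm.sign_mul, Equiv.Perm.sign_swap hlt.ne]
  rw [prod_erase_swap hij (fun a b => r (σ b) (σ a))]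
  push_cast
  ring
end
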